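/- Let R ⊆ E₁₀ be an irreducible negative definite root sublattice and R' = (R ⊗ ℚ) ∩ E₁₀ its primitive closure. Every element of the pointwise stabilizer O(E₁₀)_R reduces mod 2 to an isometry of (F₂^10, q) fixing R̄ pointwise and mapping R̄' to itself; let ξ : O(E₁₀)_R → O(E₁₀ ⊗ F₂)_{R̄, {R̄'}} denote this reduction homomorphism to the group of isometries of (F₂^10, q) that fix R̄ pointwise and preserve R̄' setwise. If R is not isometric to the A₉ root lattice, then ξ is surjective; if R is isometric to A₉, then the image of ξ has index 2 in O(E₁₀ ⊗ F₂)_{R̄, {R̄'}}. -/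

import Mathlib

open Matrix

/-- The Gram matrix of the `E₁₀` lattice. -/
def e10Gram : Matrix (Fin 10) (Fin 10) ℤ :=
  Matrix.of fun i j =>
    if i = j then -2
    else if (i.val + 1 = j.val ∧ j.val ≤ 8) ∨ (j.val + 1 = i.val ∧ i.val ≤ 8) then 1
    else if (i.val = 6 ∧ j.val = 9) ∨ (i.val = 9 ∧ j.val = 6) then 1
    else 0

/-- The even unimodular bilinear form of signature `(1,9)` on `E₁₀ = ℤ^10`. -/
def e10Form (x y : Fin 10 → ℤ) : ℤ := x ⬝ᵥ e10Gram.mulVec y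

/-- Reduction mod 2, `E₁₀ → E₁₀ ⊗ F₂ = F₂^10`. -/
def red (x : Fin 10 → ℤ) : Fin 10 → ZMod 2 := fun i => (x i : ZMod 2)

/-- The quadratic form `q(x̄) = (x·x)/2 mod 2` on `E₁₀ ⊗ F₂`. -/
def q2 (v : Fin 10 → ZMod 2) : ZMod 2 :=
  ((e10Form (fun i => ((v i).val : ℤ)) (fun i => ((v i).val : ℤ)) / 2 : ℤ) : ZMod 2)

/-- The Gram matrix of the `A₉` root lattice (a chain of 9 nodes). -/
def a9Gram : Matrix (Fin 9) (Fin 9) ℤ :=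
  Matrix.of fun i j =>
    if i = j then -2 else if i.val + 1 = j.val ∨ j.val + 1 = i.val then 1 else 0

/-- `R` is isometric to the `A₉` root lattice. -/
def IsometricToA9 (R : Submodule ℤ (Fin 10 → ℤ)) : Prop :=
  ∃ f : (Fin 9 → ℤ) →ₗ[ℤ] (Fin 10 → ℤ), Function.Injective f ∧ LinearMap.range f = R ∧
    ∀ x y : Fin 9 → ℤ, e10Form (f x) (f y) = x ⬝ᵥ a9Gram.mulVec y

local infixl:72 "⬝ₑ" => e10Form

/-- Vectors of `E₁₀`. -/
abbrev E10 := Fin 10 → ℤ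

/-- The quadratic space `E₁₀ ⊗ F₂`. -/
abbrev V10 := Fin 10 → ZMod 2

/-- The inverse of the Gram matrix of `E₁₀`. -/
def e10Inv : Matrix (Fin 10) (Fin 10) ℤ :=
  !![0, 1, 2, 3, 4, 5, 6, 4, 2, 3;
     1, 2, 4, 6, 8, 10, 12, 8, 4, 6;
     2, 4, 6, 9, 12, 15, 18, 12, 6, 9;
     3, 6, 9, 12, 16, 20, 24, 16, 8, 12;
     4, 8, 12, 16, 20, 25, 30, 20, 10, 15;
     5, 10, 15, 20, 25, 30, 36, 24, 12, 18;
     6, 12, 18, 24, 30, 36, 42, 28, 14, 21;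
     4, 8, 12, 16, 20, 24, 28, 18, 9, 14;
     2, 4, 6, 8, 10, 12, 14, 9, 4, 7;
     3, 6, 9, 12, 15, 18, 21, 14, 7, 10]

/-- The simple roots of `E₁₀`. -/
def simpleRoot (i : Fin 10) : E10 := Pi.single i 1

/-- The fundamental weights of `E₁₀`, dual to the simple roots. -/
def weight (i : Fin 10) : E10 := fun j => e10Inv j i

theorem e10Gram_mul_inv : e10Gram * e10Inv = 1 := by decide +kernel

theorem e10Gram_transpose : e10Gramᵀ = e10Gram := by decide +kernel

theorem form_comm (x y : E10) : x ⬝ₑ y = y ⬝ₑ x := by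
  rw [e10Form, e10Form, dotProduct_mulVec, dotProduct_comm, ← mulVec_transpose, e10Gram_transpose]

theorem form_add_left (x y z : E10) : (x + y) ⬝ₑ z = x ⬝ₑ z + y ⬝ₑ z := by
  simp [e10Form, add_dotProduct]

theorem form_add_right (x y z : E10) : x ⬝ₑ (y + z) = x ⬝ₑ y + x ⬝ₑ z := by
  simp [e10Form, mulVec_add, dotProduct_add]

theorem form_smul_left (c : ℤ) (x y : E10) : (c • x) ⬝ₑ y = c * (x ⬝ₑ y) := by
  rw [e10Form, smul_dotProduct, smul_eq_mul, e10Form]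

theorem form_smul_right (c : ℤ) (x y : E10) : x ⬝ₑ (c • y) = c * (x ⬝ₑ y) := by
  rw [form_comm, form_smul_left, form_comm]

theorem form_neg_left (x y : E10) : (-x) ⬝ₑ y = -(x ⬝ₑ y) := by
  simp [e10Form, neg_dotProduct]

theorem form_neg_right (x y : E10) : x ⬝ₑ (-y) = -(x ⬝ₑ y) := by
  simp [e10Form, mulVec_neg]

theorem form_sub_left (x y z : E10) : (x - y) ⬝ₑ z = x ⬝ₑ z - y ⬝ₑ z := by
  simp [e10Form, sub_dotProduct]

theorem form_sub_right (x y z : E10) : x ⬝ₑ (y - z) = x ⬝ₑ y - x ⬝ₑ z := by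
  simp [e10Form, mulVec_sub, dotProduct_sub]

theorem form_zero_left (x : E10) : 0 ⬝ₑ x = 0 := by simp [e10Form]

theorem form_zero_right (x : E10) : x ⬝ₑ 0 = 0 := by simp [e10Form]

theorem form_sum_left {ι : Type*} (s : Finset ι) (f : ι → E10) (y : E10) :
    (∑ i ∈ s, f i) ⬝ₑ y = ∑ i ∈ s, f i ⬝ₑ y := by
  simp [e10Form, sum_dotProduct]

theorem form_sum_right {ι : Type*} (s : Finset ι) (f : ι → E10) (y : E10) :
    y ⬝ₑ (∑ i ∈ s, f i) = ∑ i ∈ s, y ⬝ₑ f i := by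
  simp only [form_comm y, form_sum_left]

theorem form_simpleRoot_right (x : E10) (i : Fin 10) : x ⬝ₑ simpleRoot i = (e10Gram *ᵥ x) i := by
  rw [form_comm]; simp [e10Form, simpleRoot]

theorem form_simpleRoot_simpleRoot (i j : Fin 10) :
    simpleRoot i ⬝ₑ simpleRoot j = e10Gram i j := by
  rw [form_comm, form_simpleRoot_right]
  simp [simpleRoot, ← congrFun (congrFun e10Gram_transpose i) j]

theorem form_weight (x : E10) (i : Fin 10) : x ⬝ₑ weight i = x i := by
  have : e10Gram *ᵥ weight i = Pi.single i 1 := by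
    have h := congrArg (fun M => M *ᵥ (Pi.single i 1 : E10)) e10Gram_mul_inv
    simp only [← mulVec_mulVec, one_mulVec] at h
    rwa [show e10Inv *ᵥ (Pi.single i 1 : E10) = weight i by ext j; simp [weight]] at h
  simp [e10Form, this]

theorem weight_apply (i j : Fin 10) : weight i j = e10Inv j i := rfl

theorem form_weight_simpleRoot (i j : Fin 10) :
    weight i ⬝ₑ simpleRoot j = if i = j then 1 else 0 := by
  rw [form_comm, form_weight]; simp [simpleRoot, Pi.single_apply]

theorem eq_sum_simpleRoot (x : E10) : x = ∑ i, x i • simpleRoot i := by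
  ext j; simp [simpleRoot, Pi.single_apply]

theorem form_eq_sum (x y : E10) : x ⬝ₑ y = ∑ i, x i * (y ⬝ₑ simpleRoot i) := by
  conv_lhs => rw [eq_sum_simpleRoot x]
  simp only [form_sum_left, form_smul_left, form_comm y]

theorem form_nondegenerate {x y : E10} (h : ∀ i, x ⬝ₑ simpleRoot i = y ⬝ₑ simpleRoot i) :
    x = y := by
  ext i; rw [← form_weight x, ← form_weight y, form_comm, form_comm y, form_eq_sum, form_eq_sum _ y]
  simp [h]

theorem eq_sum_weight (x : E10) : x = ∑ i, (x ⬝ₑ simpleRoot i) • weight i := by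
  apply form_nondegenerate
  intro j
  simp only [form_sum_left, form_smul_left, form_weight_simpleRoot]
  simp

theorem form_explicit (x y : E10) : x ⬝ₑ y =
    x 0 * (-2 * y 0 + y 1) + x 1 * (y 0 - 2 * y 1 + y 2) + x 2 * (y 1 - 2 * y 2 + y 3) +
    x 3 * (y 2 - 2 * y 3 + y 4) + x 4 * (y 3 - 2 * y 4 + y 5) + x 5 * (y 4 - 2 * y 5 + y 6) +
    x 6 * (y 5 - 2 * y 6 + y 7 + y 9) + x 7 * (y 6 - 2 * y 7 + y 8) + x 8 * (y 7 - 2 * y 8) +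
    x 9 * (y 6 - 2 * y 9) := by
  rw [form_eq_sum]
  have h : e10Gram =
    !![-2, 1, 0, 0, 0, 0, 0, 0, 0, 0;
       1, -2, 1, 0, 0, 0, 0, 0, 0, 0;
       0, 1, -2, 1, 0, 0, 0, 0, 0, 0;
       0, 0, 1, -2, 1, 0, 0, 0, 0, 0;
       0, 0, 0, 1, -2, 1, 0, 0, 0, 0;
       0, 0, 0, 0, 1, -2, 1, 0, 0, 0;
       0, 0, 0, 0, 0, 1, -2, 1, 0, 1;
       0, 0, 0, 0, 0, 0, 1, -2, 1, 0;
       0, 0, 0, 0, 0, 0, 0, 1, -2, 0;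
       0, 0, 0, 0, 0, 0, 1, 0, 0, -2] := by decide +kernel
  simp only [form_simpleRoot_right, mulVec, dotProduct, h]
  simp [Fin.sum_univ_succ]
  ring

theorem two_dvd_form_self (x : E10) : 2 ∣ x ⬝ₑ x := by
  rw [form_explicit]
  exact ⟨-(x 0 ^ 2 + x 1 ^ 2 + x 2 ^ 2 + x 3 ^ 2 + x 4 ^ 2 + x 5 ^ 2 + x 6 ^ 2 + x 7 ^ 2 + x 8 ^ 2 +
    x 9 ^ 2) + x 0 * x 1 + x 1 * x 2 + x 2 * x 3 + x 3 * x 4 + x 4 * x 5 + x 5 * x 6 + x 6 * x 7 +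
    x 7 * x 8 + x 6 * x 9, by ring⟩

/-! ### Reduction modulo two -/

theorem red_eq_red_iff {x y : E10} : red x = red y ↔ ∃ z : E10, x = y + (2 : ℤ) • z := by
  constructor
  · intro h
    have : ∀ i, ∃ c, x i - y i = 2 * c := fun i =>
      (ZMod.intCast_eq_intCast_iff_dvd_sub (y i) (x i) 2).1 (congrFun h.symm i)
    choose z hz using this
    exact ⟨z, by ext i; simp [← hz]⟩
  · rintro ⟨z, rfl⟩
    ext i; simp [red, show (2 : ZMod 2) = 0 from rfl]

theorem red_add (x y : E10) : red (x + y) = red x + red y := by ext i; simp [red]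

theorem red_smul (c : ℤ) (x : E10) : red (c • x) = (c : ZMod 2) • red x := by ext i; simp [red]

theorem red_zero : red 0 = 0 := by ext i; simp [red]

theorem red_lift (v : V10) : red (fun i => ((v i).val : ℤ)) = v := by
  ext i; simp [red]

theorem red_surjective : Function.Surjective red := fun v => ⟨_, red_lift v⟩

theorem q2_eq_q2_iff {x y : E10} : q2 (red x) = q2 (red y) ↔ 4 ∣ x ⬝ₑ x - y ⬝ₑ y := by
  have key : ∀ x : E10, q2 (red x) = ((x ⬝ₑ x / 2 : ℤ) : ZMod 2) := by
    intro x
    obtain ⟨z, hz⟩ := red_eq_red_iff.1 (red_lift (red x)).symm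
    set y : E10 := fun i => ((red x i).val : ℤ) with hy
    obtain ⟨c, hc⟩ := two_dvd_form_self y
    obtain ⟨d, hd⟩ := two_dvd_form_self x
    have : d = c + 2 * (y ⬝ₑ z + z ⬝ₑ z) := by
      have h2 : x ⬝ₑ x = y ⬝ₑ y + 2 * (y ⬝ₑ z) + 2 * (y ⬝ₑ z) + 4 * (z ⬝ₑ z) := by
        rw [hz]
        simp only [form_add_left, form_add_right, form_smul_left, form_smul_right, form_comm z y]
        ring
      linarith
    rw [q2, ← hy, hd, hc, this]
    simp [show (2 : ZMod 2) = 0 from rfl]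
  rw [key, key, eq_comm, ZMod.intCast_eq_intCast_iff_dvd_sub]
  obtain ⟨c, hc⟩ := two_dvd_form_self y
  obtain ⟨d, hd⟩ := two_dvd_form_self x
  rw [hc, hd]; push_cast; omega

theorem q2_eq_one_iff {x : E10} : q2 (red x) = 1 ↔ ¬ 4 ∣ x ⬝ₑ x := by
  have h0 : q2 (red 0) = 0 := by decide +kernel
  have := @q2_eq_q2_iff x 0
  rw [h0, form_zero_left, sub_zero] at this
  rw [← this]
  generalize q2 (red x) = a
  revert a; decide

/-! ### Isometries of `E₁₀` -/

/-- A linear endomorphism of `E₁₀` preserving the bilinear form. -/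
def PreservesForm (g : E10 →ₗ[ℤ] E10) : Prop := ∀ a b, g a ⬝ₑ g b = a ⬝ₑ b

/-- An automorphism of `E₁₀ ⊗ F₂` preserving the quadratic form. -/
def PreservesQ (h : V10 →ₗ[ZMod 2] V10) : Prop := ∀ v, q2 (h v) = q2 v

/-- The form as a linear functional of its first argument. -/
def formRight (y : E10) : E10 →ₗ[ℤ] ℤ where
  toFun x := x ⬝ₑ y
  map_add' a b := form_add_left a b y
  map_smul' c a := form_smul_left c a y

@[simp] theorem formRight_apply (x y : E10) : formRight y x = x ⬝ₑ y := rfl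

theorem PreservesForm.exists_equiv {g : E10 →ₗ[ℤ] E10} (hg : PreservesForm g) :
    ∃ e : E10 ≃ₗ[ℤ] E10, (e : E10 →ₗ[ℤ] E10) = g := by
  let ψ : E10 →ₗ[ℤ] E10 := ∑ i, (formRight (g (simpleRoot i))).smulRight (weight i)
  have h1 : ψ * g = 1 := by
    ext1 i
    ext1
    simp only [ψ, LinearMap.comp_apply, Module.End.mul_apply, LinearMap.sum_apply,
      LinearMap.smulRight_apply, formRight_apply, hg _ _, ← eq_sum_weight]
    rfl
  have h2 : g * ψ = 1 := mul_eq_one_comm.1 h1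
  exact ⟨LinearEquiv.ofLinearMap g ψ h2 h1, rfl⟩

theorem exists_linearMap_simpleRoot {M : Type*} [AddCommGroup M] (w : Fin 10 → M) :
    ∃ g : E10 →ₗ[ℤ] M, ∀ i, g (simpleRoot i) = w i := by
  refine ⟨(Pi.basisFun ℤ (Fin 10)).constr ℤ w, fun i => ?_⟩
  rw [simpleRoot, ← Pi.basisFun_apply, Module.Basis.constr_basis]

theorem preservesForm_of_simpleRoot {g : E10 →ₗ[ℤ] E10}
    (h : ∀ i j, g (simpleRoot i) ⬝ₑ g (simpleRoot j) = simpleRoot i ⬝ₑ simpleRoot j) :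
    PreservesForm g := by
  intro a b
  rw [eq_sum_simpleRoot a, eq_sum_simpleRoot b]
  simp only [map_sum, map_smul, form_sum_left, form_sum_right, form_smul_left, form_smul_right, h]

theorem exists_preservesForm (w : Fin 10 → E10) (hw : ∀ i j, w i ⬝ₑ w j = e10Gram i j) :
    ∃ g : E10 →ₗ[ℤ] E10, PreservesForm g ∧ ∀ i, g (simpleRoot i) = w i := by
  obtain ⟨g, hg⟩ := exists_linearMap_simpleRoot w
  exact ⟨g, preservesForm_of_simpleRoot fun i j => by
    rw [hg, hg, hw, form_simpleRoot_simpleRoot], hg⟩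

theorem PreservesForm.comp {g g' : E10 →ₗ[ℤ] E10} (hg : PreservesForm g) (hg' : PreservesForm g') :
    PreservesForm (g ∘ₗ g') := fun a b => by simp [hg _ _, hg' _ _]

theorem PreservesForm.symm {e : E10 ≃ₗ[ℤ] E10} (he : PreservesForm (e : E10 →ₗ[ℤ] E10)) :
    PreservesForm (e.symm : E10 →ₗ[ℤ] E10) := fun a b => by
  have := he (e.symm a) (e.symm b)
  simpa using this.symm

theorem PreservesForm.injective {g : E10 →ₗ[ℤ] E10} (hg : PreservesForm g) :
    Function.Injective g := by
  obtain ⟨e, rfl⟩ := hg.exists_equiv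
  exact e.injective

theorem preservesForm_id : PreservesForm LinearMap.id := fun _ _ => rfl

/-- The reflection in a root. -/
def rootReflection (r : E10) : E10 →ₗ[ℤ] E10 := LinearMap.id + (formRight r).smulRight r

theorem rootReflection_apply (r x : E10) : rootReflection r x = x + (x ⬝ₑ r) • r := rfl

theorem rootReflection_preservesForm {r : E10} (hr : r ⬝ₑ r = -2) :
    PreservesForm (rootReflection r) := by
  intro a b
  simp only [rootReflection_apply, form_add_left, form_add_right, form_smul_left, form_smul_right,
    hr, form_comm r]
  ring

/-- The Eichler transvection attached to an isotropic vector `u` and `m ⊥ u` with `m·m = 2 * n`. -/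
def eichler (u m : E10) (n : ℤ) : E10 →ₗ[ℤ] E10 :=
  LinearMap.id + (formRight u).smulRight m - (formRight m).smulRight u -
    (n • formRight u).smulRight u

theorem eichler_apply (u m : E10) (n : ℤ) (x : E10) :
    eichler u m n x = x + (x ⬝ₑ u) • m - (x ⬝ₑ m) • u - (n * (x ⬝ₑ u)) • u := rfl

theorem eichler_preservesForm {u m : E10} {n : ℤ} (hu : u ⬝ₑ u = 0) (hm : m ⬝ₑ u = 0)
    (hn : m ⬝ₑ m = 2 * n) : PreservesForm (eichler u m n) := by
  intro a b
  simp only [eichler_apply, form_add_left, form_add_right, form_smul_left, form_smul_right,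
    form_sub_left, form_sub_right, form_comm u b, form_comm m b, hu, hm, hn,
    (form_comm u m).trans hm]
  ring

theorem exists_reduction_linearMap (g : E10 →ₗ[ℤ] E10) :
    ∃ h : V10 →ₗ[ZMod 2] V10, ∀ x, red (g x) = h (red x) := by
  refine ⟨(Pi.basisFun (ZMod 2) (Fin 10)).constr ℤ (fun i => red (g (simpleRoot i))), fun x => ?_⟩
  have : ∀ i, (x i : ZMod 2) = red x i := fun i => rfl
  conv_lhs => rw [eq_sum_simpleRoot x]
  simp only [Module.Basis.constr_apply_fintype, Pi.basisFun_equivFun, LinearEquiv.refl_apply,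
    map_sum, map_smul]
  have hs : ∀ f : Fin 10 → E10, red (∑ i, f i) = ∑ i, red (f i) := fun f => by
    ext j; simp [red]
  simp only [hs, red_smul, this]

theorem PreservesForm.exists_reduction {e : E10 ≃ₗ[ℤ] E10}
    (he : PreservesForm (e : E10 →ₗ[ℤ] E10)) :
    ∃ h : V10 ≃ₗ[ZMod 2] V10, PreservesQ h ∧ ∀ x, red (e x) = h (red x) := by
  obtain ⟨h, hh⟩ := exists_reduction_linearMap e
  obtain ⟨h', hh'⟩ := exists_reduction_linearMap e.symm
  have h1 : h ∘ₗ h' = LinearMap.id := LinearMap.ext fun v => by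
    obtain ⟨x, rfl⟩ := red_surjective v
    simp [← hh', ← hh]
  have h2 : h' ∘ₗ h = LinearMap.id := LinearMap.ext fun v => by
    obtain ⟨x, rfl⟩ := red_surjective v
    simp [← hh', ← hh]
  refine ⟨LinearEquiv.ofLinearMap h h' h1 h2, fun v => ?_, fun x => hh x⟩
  obtain ⟨x, rfl⟩ := red_surjective v
  have : q2 (red (e x)) = q2 (red x) :=
    q2_eq_q2_iff.2 (by simp [show e x ⬝ₑ e x = x ⬝ₑ x from he x x])
  simpa [← hh] using this

theorem form_lift_parity {h : V10 →ₗ[ZMod 2] V10} (hq : PreservesQ h) {x y x' y' : E10}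
    (hx : red x' = h (red x)) (hy : red y' = h (red y)) : 2 ∣ x' ⬝ₑ y' - x ⬝ₑ y := by
  have h1 : 4 ∣ x' ⬝ₑ x' - x ⬝ₑ x := q2_eq_q2_iff.1 (by rw [hx, hq])
  have h2 : 4 ∣ y' ⬝ₑ y' - y ⬝ₑ y := q2_eq_q2_iff.1 (by rw [hy, hq])
  have h3 : 4 ∣ (x' + y') ⬝ₑ (x' + y') - (x + y) ⬝ₑ (x + y) :=
    q2_eq_q2_iff.1 (by rw [red_add, red_add, hx, hy, ← map_add, hq])
  simp only [form_add_left, form_add_right, form_comm y x, form_comm y' x'] at h3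
  omega

theorem form_self_lift {h : V10 →ₗ[ZMod 2] V10} (hq : PreservesQ h) {x x' : E10}
    (hx : red x' = h (red x)) : 4 ∣ x' ⬝ₑ x' - x ⬝ₑ x := q2_eq_q2_iff.1 (by rw [hx, hq])

/-! ### The signature of `E₁₀` -/

theorem form_self_of_coord_one_eq_zero {z : E10} (hz : z 1 = 0) (h : 0 ≤ z ⬝ₑ z) : z = 0 := by
  have key : 60 * (z ⬝ₑ z) = -(120 * z 0 ^ 2 + 30 * (2 * z 2 - z 3) ^ 2 +
      10 * (3 * z 3 - 2 * z 4) ^ 2 + 5 * (4 * z 4 - 3 * z 5) ^ 2 + 3 * (5 * z 5 - 4 * z 6) ^ 2 +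
      30 * (2 * z 9 - z 6) ^ 2 + 30 * (2 * z 8 - z 7) ^ 2 + 10 * (3 * z 7 - 2 * z 6) ^ 2 +
      2 * z 6 ^ 2) := by
    rw [form_explicit, hz]; ring
  have sq : ∀ {a : ℤ}, a ^ 2 ≤ 0 → a = 0 := fun h =>
    (pow_eq_zero_iff two_ne_zero).1 (le_antisymm h (sq_nonneg _))
  have h6 : z 6 = 0 := sq (by
        nlinarith only [key, h, sq_nonneg (z 0), sq_nonneg (2 * z 2 - z 3), sq_nonneg (3 * z 3 - 2 *
      z 4), sq_nonneg (4 * z 4 - 3 * z 5), sq_nonneg (5 * z 5 - 4 * z 6), sq_nonneg (2 * z 9 - z 6),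
      sq_nonneg (2 * z 8 - z 7), sq_nonneg (3 * z 7 - 2 * z 6)])
  have h0 : z 0 = 0 := sq (by
        nlinarith only [key, h, sq_nonneg (z 6), sq_nonneg (2 * z 2 - z 3), sq_nonneg (3 * z 3 - 2 *
      z 4), sq_nonneg (4 * z 4 - 3 * z 5), sq_nonneg (5 * z 5 - 4 * z 6), sq_nonneg (2 * z 9 - z 6),
      sq_nonneg (2 * z 8 - z 7), sq_nonneg (3 * z 7 - 2 * z 6)])
  rw [h6, h0] at key
  have h5 : z 5 = 0 := sq (by
        nlinarith only [key, h, sq_nonneg (2 * z 2 - z 3), sq_nonneg (3 * z 3 - 2 * z 4),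
      sq_nonneg (4 * z 4 - 3 * z 5), sq_nonneg (z 9), sq_nonneg (2 * z 8 - z 7), sq_nonneg (z 7)])
  have h7 : z 7 = 0 := sq (by
        nlinarith only [key, h, sq_nonneg (2 * z 2 - z 3), sq_nonneg (3 * z 3 - 2 * z 4),
      sq_nonneg (4 * z 4 - 3 * z 5), sq_nonneg (z 9), sq_nonneg (2 * z 8 - z 7), sq_nonneg (z 5)])
  have h9 : z 9 = 0 := sq (by
        nlinarith only [key, h, sq_nonneg (2 * z 2 - z 3), sq_nonneg (3 * z 3 - 2 * z 4),
      sq_nonneg (4 * z 4 - 3 * z 5), sq_nonneg (z 7), sq_nonneg (2 * z 8 - z 7), sq_nonneg (z 5)])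
  rw [h5, h7, h9] at key
  have h4 : z 4 = 0 := sq (by
        nlinarith only [key, h, sq_nonneg (2 * z 2 - z 3), sq_nonneg (3 * z 3 - 2 * z 4),
      sq_nonneg (z 8)])
  have h8 : z 8 = 0 := sq (by
        nlinarith only [key, h, sq_nonneg (2 * z 2 - z 3), sq_nonneg (3 * z 3 - 2 * z 4),
      sq_nonneg (z 4)])
  rw [h4, h8] at key
  have h3 : z 3 = 0 := sq (by
    nlinarith only [key, h, sq_nonneg (2 * z 2 - z 3)])
  have h2 : z 2 = 0 := sq (by rw [h3] at key; nlinarith only [key, h])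
  ext i
  fin_cases i <;> simpa

theorem form_self_neg_of_orthogonal {x y : E10} (hx : 0 < x ⬝ₑ x) (hxy : x ⬝ₑ y = 0)
    (hy : y ≠ 0) : y ⬝ₑ y < 0 := by
  by_contra! h
  have hx1 : x 1 ≠ 0 := fun h1 => by
    rw [form_self_of_coord_one_eq_zero h1 hx.le, form_zero_left] at hx
    exact hx.ne rfl
  have hz : x 1 • y - y 1 • x = 0 := by
    apply form_self_of_coord_one_eq_zero
    · simp [mul_comm]
    · simp only [form_sub_left, form_sub_right, form_smul_left, form_smul_right, hxy,
        form_comm y x]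
      nlinarith [mul_nonneg (mul_self_nonneg (x 1)) h, mul_nonneg (mul_self_nonneg (y 1)) hx.le]
  have h1 : y 1 * (x ⬝ₑ x) = 0 := by
    have := congrArg (fun v => x ⬝ₑ v) hz
    simpa only [form_sub_right, form_smul_right, hxy, form_zero_right, mul_zero, zero_sub,
      neg_eq_zero] using this
  rw [(mul_eq_zero.1 h1).resolve_right hx.ne', zero_smul, sub_zero] at hz
  exact hy ((smul_eq_zero.1 hz).resolve_left hx1)

theorem form_self_le_neg_two {y : E10} {k : Fin 10} (hk : k ≠ 0) (hyk : y k = 0) (hy : y ≠ 0) :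
    y ⬝ₑ y ≤ -2 := by
  have hw : 0 < weight k ⬝ₑ weight k := by
    rw [form_weight]
    exact (by decide +kernel : ∀ k ≠ 0, 0 < weight k k) k hk
  have h := form_self_neg_of_orthogonal hw (by rw [form_comm, form_weight, hyk]) hy
  have := two_dvd_form_self y
  omega

theorem form_self_nonpos {y : E10} (hy : y 0 = 0) : y ⬝ₑ y ≤ 0 := by
  by_contra! h
  have := form_self_neg_of_orthogonal h (by rw [form_weight, hy]) (y := weight 0)
    (fun h => by have := congrFun h 1; revert this; decide +kernel)
  rw [form_weight] at this
  revert this; decide +kernel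

theorem form_eq_double_sum (x y : E10) : x ⬝ₑ y = ∑ i, ∑ j, x i * (e10Gram i j * y j) := by
  simp only [e10Form, dotProduct, mulVec, Finset.mul_sum]

theorem e10Gram_nonneg {i j : Fin 10} (h : i ≠ j) : 0 ≤ e10Gram i j := by
  have : ∀ i j : Fin 10, i ≠ j → 0 ≤ e10Gram i j := by
    simp only [e10Gram, of_apply]; decide +kernel
  exact this i j h

theorem form_nonneg_of_disjoint {p n : E10} (hp : ∀ i, 0 ≤ p i) (hn : ∀ i, 0 ≤ n i)
    (hd : ∀ i, p i = 0 ∨ n i = 0) : 0 ≤ p ⬝ₑ n := by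
  rw [form_eq_double_sum]
  refine Finset.sum_nonneg fun i _ => Finset.sum_nonneg fun j _ => ?_
  rcases eq_or_ne i j with rfl | hij
  · rcases hd i with h | h <;> simp [h]
  · exact mul_nonneg (hp i) (mul_nonneg (e10Gram_nonneg hij) (hn j))

theorem form_sub_self_le_of_supported {p n : E10} (hp : ∀ i, 0 ≤ p i) (hn : ∀ i, 0 ≤ n i)
    (hd : ∀ i, p i = 0 ∨ n i = 0) (hp0 : p ≠ 0) (hn0 : n ≠ 0) (hs : ∀ k ≠ 0, n k = 0) :
    (p - n) ⬝ₑ (p - n) ≤ -4 := by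
  have hn1 : n 0 ≠ 0 := fun h => hn0 (funext fun k => by
    rcases eq_or_ne k 0 with rfl | hk
    exacts [h, hs k hk])
  have hp1 : p 0 = 0 := (hd 0).resolve_right hn1
  have hpn := form_nonneg_of_disjoint hp hn hd
  have hnn := form_self_le_neg_two one_ne_zero (hs 1 one_ne_zero) hn0
  rw [form_sub_left, form_sub_right, form_sub_right, form_comm n p]
  rcases (hp 1).eq_or_lt with h1 | h1
  · have := form_self_le_neg_two one_ne_zero h1.symm hp0
    omega
  · have : p ⬝ₑ n = p 1 * n 0 := by
      rw [form_explicit, hp1]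
      simp [hs]
    have h3 := mul_pos h1 ((hn 0).lt_of_ne' hn1)
    have := form_self_nonpos hp1
    omega

theorem root_nonneg_or_nonpos {r : E10} (hr : r ⬝ₑ r = -2) : (∀ i, 0 ≤ r i) ∨ ∀ i, r i ≤ 0 := by
  by_contra! h
  obtain ⟨⟨a, ha⟩, b, hb⟩ := h
  let p : E10 := fun i => max (r i) 0
  let n : E10 := fun i => max (-r i) 0
  have hpn : r = p - n := by ext i; simp only [p, n, Pi.sub_apply]; omega
  have hp : ∀ i, 0 ≤ p i := fun i => le_max_right _ _
  have hn : ∀ i, 0 ≤ n i := fun i => le_max_right _ _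
  have hd : ∀ i, p i = 0 ∨ n i = 0 := fun i => by simp only [p, n]; omega
  have hpb : p b ≠ 0 := by simp only [p]; omega
  have hna : n a ≠ 0 := by simp only [n]; omega
  have hp0 : p ≠ 0 := fun h => hpb (congrFun h b)
  have hn0 : n ≠ 0 := fun h => hna (congrFun h a)
  by_cases hsn : ∀ k ≠ 0, n k = 0
  · have := form_sub_self_le_of_supported hp hn hd hp0 hn0 hsn
    rw [← hpn] at this; omega
  by_cases hsp : ∀ k ≠ 0, p k = 0
  · have := form_sub_self_le_of_supported hn hp (fun i => (hd i).symm) hn0 hp0 hsp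
    rw [← neg_sub, ← hpn, form_neg_left, form_neg_right] at this; omega
  push Not at hsn hsp
  obtain ⟨k, hk, hnk⟩ := hsn
  obtain ⟨l, hl, hpl⟩ := hsp
  have h1 := form_self_le_neg_two hk ((hd k).resolve_right hnk) hp0
  have h2 := form_self_le_neg_two hl ((hd l).resolve_left hpl) hn0
  have h3 := form_nonneg_of_disjoint hp hn hd
  rw [hpn, form_sub_left, form_sub_right, form_sub_right, form_comm n p] at hr
  omega

/-- The Weyl vector, with product `1` with every simple root. -/
def weylVector : E10 := ![30, 61, 93, 126, 160, 195, 231, 153, 76, 115]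

theorem weylVector_form_simpleRoot (i : Fin 10) : weylVector ⬝ₑ simpleRoot i = 1 := by
  rw [form_simpleRoot_right]; revert i; decide +kernel

theorem weylVector_form_self : weylVector ⬝ₑ weylVector = 1240 := by decide +kernel

theorem simpleRoot_form_self (i : Fin 10) : simpleRoot i ⬝ₑ simpleRoot i = -2 := by
  rw [form_simpleRoot_simpleRoot]; revert i; decide +kernel

theorem exists_dominant (J : Set (Fin 10)) (z : E10) (hz : 0 < z ⬝ₑ z)
    (hzρ : 0 < z ⬝ₑ weylVector) : ∃ g : E10 →ₗ[ℤ] E10, PreservesForm g ∧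
      (∀ x, (∀ j ∈ J, x ⬝ₑ simpleRoot j = 0) → g x = x) ∧ ∀ j ∈ J, 0 ≤ g z ⬝ₑ simpleRoot j := by
  induction hn : (z ⬝ₑ weylVector).toNat using Nat.strong_induction_on generalizing z with
  | _ n ih =>
    by_cases h : ∀ j ∈ J, 0 ≤ z ⬝ₑ simpleRoot j
    · exact ⟨LinearMap.id, preservesForm_id, fun _ _ => rfl, h⟩
    push Not at h
    obtain ⟨j, hj, hjz⟩ := h
    have hs := rootReflection_preservesForm (simpleRoot_form_self j)
    have hval : rootReflection (simpleRoot j) z ⬝ₑ weylVector =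
        z ⬝ₑ weylVector + z ⬝ₑ simpleRoot j := by
      rw [rootReflection_apply, form_add_left, form_smul_left, form_comm (simpleRoot j),
        weylVector_form_simpleRoot, mul_one]
    have hpos : 0 < z ⬝ₑ weylVector + z ⬝ₑ simpleRoot j := by
      by_contra! hle
      set a := z ⬝ₑ weylVector
      set b := z ⬝ₑ simpleRoot j
      let y := (-(a + b)) • weylVector + a • (weylVector + simpleRoot j)
      have hy : y ⬝ₑ y = 1240 * (a + b) ^ 2 + 1240 * a ^ 2 + 2482 * (a * -(a + b)) := by
        simp only [y, form_add_left, form_add_right, form_smul_left, form_smul_right,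
          form_comm (simpleRoot j) weylVector, weylVector_form_simpleRoot, weylVector_form_self,
          simpleRoot_form_self]
        ring
      have hy0 : 0 < y ⬝ₑ y := by
        rw [hy]; nlinarith [mul_nonneg hzρ.le (neg_nonneg.2 hle), pow_pos hzρ 2]
      refine (form_self_neg_of_orthogonal hz (y := y) ?_ ?_).not_gt hy0
      · simp only [y, form_add_right, form_smul_right]
        simp only [a, b]; ring
      · rintro h; rw [h, form_zero_left] at hy0; exact hy0.ne rfl
    obtain ⟨g, hg, hfix, hdom⟩ := ih (rootReflection (simpleRoot j) z ⬝ₑ weylVector).toNat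
      (by omega) (rootReflection (simpleRoot j) z) (by rwa [hs]) (by rwa [hval]) rfl
    refine ⟨g ∘ₗ rootReflection (simpleRoot j), hg.comp hs, fun x hx => ?_, hdom⟩
    rw [LinearMap.comp_apply, rootReflection_apply, hx j hj, zero_smul, add_zero, hfix x hx]

theorem exists_orthogonal_pos (R : Submodule ℤ E10) (hneg : ∀ x ∈ R, x ≠ 0 → x ⬝ₑ x < 0) :
    ∃ x, 0 < x ⬝ₑ x ∧ ∀ r ∈ R, r ⬝ₑ x = 0 := by
  classical
  let b := Module.Free.chooseBasis ℤ R
  let G : Matrix _ _ ℤ := Matrix.of fun i j => (b i : E10) ⬝ₑ (b j : E10)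
  have hd : G.det ≠ 0 := by
    intro h
    obtain ⟨c, hc, hGc⟩ := Matrix.exists_mulVec_eq_zero_iff.2 h
    have hcoe : ((∑ i, c i • b i : R) : E10) = ∑ i, c i • (b i : E10) := by
      simp [-zsmul_eq_mul]
    have h0 : (∑ i, c i • b i : R) ≠ 0 := fun h0 => hc (funext fun i => by
      simpa using Fintype.linearIndependent_iff.1 b.linearIndependent c h0 i)
    refine (hneg _ (∑ i, c i • b i : R).2 fun h => h0 (Subtype.ext h)).ne ?_
    rw [hcoe, form_sum_left]
    refine Finset.sum_eq_zero fun i _ => ?_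
    have := congrFun hGc i
    simp only [mulVec, dotProduct, G, of_apply, Pi.zero_apply] at this
    rw [form_smul_left, form_sum_right]
    simp only [form_smul_right, mul_comm (c _), this, zero_mul]
  let y : R := ∑ j, ∑ k, (weylVector ⬝ₑ (b j : E10) * G.adjugate j k) • b k
  have hy : (y : E10) = ∑ j, ∑ k, (weylVector ⬝ₑ (b j : E10) * G.adjugate j k) • (b k : E10) := by
    simp [y, -zsmul_eq_mul]
  have horth : ∀ r ∈ R, r ⬝ₑ (G.det • weylVector - y) = 0 := by
    have hb : ∀ i, (b i : E10) ⬝ₑ (G.det • weylVector - y) = 0 := by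
      intro i
      have hadj : ∀ j, ∑ k, G.adjugate j k * G k i = if j = i then G.det else 0 := fun j => by
        have := congrFun (congrFun (adjugate_mul G) j) i
        rwa [Matrix.mul_apply, Matrix.smul_apply, Matrix.one_apply, smul_eq_mul, mul_ite, mul_one,
          mul_zero] at this
      have h' : (b i : E10) ⬝ₑ y = ∑ j, weylVector ⬝ₑ (b j : E10) *
          ∑ k, G.adjugate j k * (b k : E10) ⬝ₑ (b i : E10) := by
        rw [hy]
        rw [form_comm]
        simp only [form_sum_left, form_smul_left, mul_assoc, Finset.mul_sum]
      have h'' : ∀ j, ∑ k, G.adjugate j k * (b k : E10) ⬝ₑ (b i : E10) =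
          if j = i then G.det else 0 := hadj
      rw [form_sub_right, form_smul_right, h', form_comm (b i : E10)]
      simp only [h'']
      simp [mul_comm]
    intro r hr
    have := b.sum_repr ⟨r, hr⟩
    have hr' : r = ∑ i, b.repr ⟨r, hr⟩ i • (b i : E10) := by
      simpa [-zsmul_eq_mul, -Module.Basis.sum_repr] using (congrArg Subtype.val this).symm
    rw [hr', form_sum_left]
    simp only [form_smul_left, hb, mul_zero, Finset.sum_const_zero]
  refine ⟨G.det • weylVector - y, ?_, horth⟩
  have h1 := horth y y.2
  have h2 : (y : E10) ⬝ₑ (y : E10) ≤ 0 := by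
    rcases eq_or_ne (y : E10) 0 with h | h
    · rw [h, form_zero_left]
    · exact (hneg y y.2 h).le
  have h3 := weylVector_form_self
  simp only [form_sub_left, form_sub_right, form_smul_left, form_smul_right] at h1 ⊢
  rw [form_comm (y : E10) weylVector] at h1 ⊢
  have h4 : 0 < G.det * G.det := mul_self_pos.2 hd
  rw [h3]
  nlinarith

/-! ### Root sublattices supported on the simple roots -/

/-- A sublattice generated by its roots, which do not split into orthogonal parts. -/
structure IsIrreducibleRootLattice (R : Submodule ℤ E10) : Prop where
  span_roots : R ≤ Submodule.span ℤ {r | r ∈ R ∧ r ⬝ₑ r = -2}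
  irreducible : ∀ P : E10 → Prop, (∀ s ∈ R, s ⬝ₑ s = -2 → ∀ t ∈ R, t ⬝ₑ t = -2 → P s → ¬ P t →
    s ⬝ₑ t = 0) → (∀ s ∈ R, s ⬝ₑ s = -2 → P s) ∨ ∀ s ∈ R, s ⬝ₑ s = -2 → ¬ P s

/-- `R` is supported on the simple roots in `J`, and these lie in its rational span. -/
structure IsSupportedOn (R : Submodule ℤ E10) (J : Set (Fin 10)) : Prop where
  apply_eq_zero : ∀ r ∈ R, ∀ i ∉ J, r i = 0
  full : ∀ y, (∀ r ∈ R, y ⬝ₑ r = 0) → ∀ j ∈ J, y ⬝ₑ simpleRoot j = 0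

theorem IsIrreducibleRootLattice.induction {R : Submodule ℤ E10} (hR : IsIrreducibleRootLattice R)
    {S : Submodule ℤ E10} (h : ∀ r ∈ R, r ⬝ₑ r = -2 → r ∈ S) : R ≤ S :=
  hR.span_roots.trans (Submodule.span_le.2 fun r hr => h r hr.1 hr.2)

theorem IsIrreducibleRootLattice.map {R : Submodule ℤ E10} (hR : IsIrreducibleRootLattice R)
    {g : E10 →ₗ[ℤ] E10} (hg : PreservesForm g) : IsIrreducibleRootLattice (R.map g) where
  span_roots := by
    rintro _ ⟨r, hr, rfl⟩
    have := hR.induction (S := (Submodule.span ℤ {r | r ∈ R.map g ∧ r ⬝ₑ r = -2}).comap g)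
      fun r hr hrr => Submodule.subset_span ⟨⟨r, hr, rfl⟩, by rw [hg, hrr]⟩
    exact this hr
  irreducible P hP := by
    refine (hR.irreducible (fun r => P (g r)) fun s hs hss t ht htt h1 h2 => ?_).imp ?_ ?_
    · rw [← hg]
      exact hP _ ⟨s, hs, rfl⟩ (by rw [hg, hss]) _ ⟨t, ht, rfl⟩ (by rw [hg, htt]) h1 h2
    · rintro h _ ⟨s, hs, rfl⟩ hss
      exact h s hs (by rwa [hg] at hss)
    · rintro h _ ⟨s, hs, rfl⟩ hss
      exact h s hs (by rwa [hg] at hss)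

theorem eventually_linear_pos {a : ℤ} (ha : 0 < a) (b : ℤ) :
    ∀ᶠ N : ℤ in Filter.atTop, 0 < N * a + b := by
  filter_upwards [Filter.eventually_gt_atTop |b|] with N hN
  nlinarith [neg_abs_le b, abs_nonneg b]

theorem eventually_form_self_pos {x : E10} (hx : 0 < x ⬝ₑ x) (y : E10) :
    ∀ᶠ N : ℤ in Filter.atTop, 0 < (N • x + y) ⬝ₑ (N • x + y) := by
  filter_upwards [Filter.eventually_gt_atTop 0,
    eventually_linear_pos hx (2 * (x ⬝ₑ y) - |y ⬝ₑ y|)] with N hN h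
  simp only [form_add_left, form_add_right, form_smul_left, form_smul_right, form_comm y x]
  nlinarith [neg_abs_le (y ⬝ₑ y), abs_nonneg (y ⬝ₑ y)]

theorem form_weylVector_pos {x : E10} (hx : 0 < x ⬝ₑ x) (hd : ∀ i, 0 ≤ x ⬝ₑ simpleRoot i) :
    0 < x ⬝ₑ weylVector := by
  have hρ : ∀ i, 0 ≤ weylVector i := by decide +kernel
  refine lt_of_le_of_ne ?_ fun h => ?_
  · rw [form_comm, form_eq_sum]
    exact Finset.sum_nonneg fun i _ => mul_nonneg (hρ i) (hd i)
  · have := form_self_neg_of_orthogonal hx h.symm (by decide +kernel)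
    rw [weylVector_form_self] at this
    omega

theorem exists_dominant_orthogonal {R : Submodule ℤ E10} (hneg : ∀ x ∈ R, x ≠ 0 → x ⬝ₑ x < 0) :
    ∃ (g : E10 →ₗ[ℤ] E10) (x : E10), PreservesForm g ∧ 0 < x ⬝ₑ x ∧
      (∀ i, 0 ≤ x ⬝ₑ simpleRoot i) ∧ ∀ r ∈ R, g r ⬝ₑ x = 0 := by
  obtain ⟨x, hx, hxR⟩ := exists_orthogonal_pos R hneg
  have hρ : x ⬝ₑ weylVector ≠ 0 := fun h => by
    have := form_self_neg_of_orthogonal hx h (by decide +kernel)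
    rw [weylVector_form_self] at this
    omega
  obtain ⟨y, hy, hyR, hyρ⟩ : ∃ y, 0 < y ⬝ₑ y ∧ (∀ r ∈ R, r ⬝ₑ y = 0) ∧ 0 < y ⬝ₑ weylVector := by
    rcases hρ.lt_or_gt with h | h
    · refine ⟨-x, by simpa [form_neg_left, form_neg_right] using hx, fun r hr => ?_, ?_⟩
      · rw [form_neg_right, hxR r hr, neg_zero]
      · rw [form_neg_left]; omega
    · exact ⟨x, hx, hxR, h⟩
  obtain ⟨g, hg, -, hdom⟩ := exists_dominant Set.univ y hy hyρ
  exact ⟨g, g y, hg, by rwa [hg], fun i => hdom i trivial, fun r hr => by rw [hg, hyR r hr]⟩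

theorem exists_isSupportedOn {R : Submodule ℤ E10} (hR : IsIrreducibleRootLattice R)
    (hneg : ∀ x ∈ R, x ≠ 0 → x ⬝ₑ x < 0) :
    ∃ (g : E10 →ₗ[ℤ] E10) (x : E10), PreservesForm g ∧ 0 < x ⬝ₑ x ∧
      (∀ i, 0 ≤ x ⬝ₑ simpleRoot i) ∧ IsSupportedOn (R.map g) {i | x ⬝ₑ simpleRoot i = 0} := by
  classical
  have hex : ∃ n, ∃ (g : E10 →ₗ[ℤ] E10) (x : E10), PreservesForm g ∧ 0 < x ⬝ₑ x ∧
      (∀ i, 0 ≤ x ⬝ₑ simpleRoot i) ∧ (∀ r ∈ R, g r ⬝ₑ x = 0) ∧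
      (Finset.univ.filter fun i => x ⬝ₑ simpleRoot i = 0).card = n := by
    obtain ⟨g, x, hg, hx, hd, ho⟩ := exists_dominant_orthogonal hneg
    exact ⟨_, g, x, hg, hx, hd, ho, rfl⟩
  obtain ⟨g, x, hg, hx, hd, ho, hn⟩ := Nat.find_spec hex
  refine ⟨g, x, hg, hx, hd, ?_, ?_⟩
  · rintro r hr i hi
    have hle : R.map g ≤ LinearMap.ker (LinearMap.proj i : E10 →ₗ[ℤ] ℤ) := by
      refine (hR.map hg).induction fun r hr hrr => LinearMap.mem_ker.2 ?_
      obtain ⟨s, hs, rfl⟩ := hr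
      have hxi : 0 < x ⬝ₑ simpleRoot i := (hd i).lt_of_ne' hi
      have h0 := ho s hs
      rw [form_eq_sum] at h0
      have h0i : g s i * (x ⬝ₑ simpleRoot i) = 0 := by
        rcases root_nonneg_or_nonpos hrr with h | h
        · exact (Finset.sum_eq_zero_iff_of_nonneg fun i _ => mul_nonneg (h i) (hd i)).1 h0 i
            (Finset.mem_univ i)
        · exact (Finset.sum_eq_zero_iff_of_nonpos fun i _ =>
            mul_nonpos_of_nonpos_of_nonneg (h i) (hd i)).1 h0 i (Finset.mem_univ i)
      exact (mul_eq_zero.1 h0i).resolve_right hxi.ne'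
    exact hle hr
  · intro y hy j hj
    by_contra hyj
    obtain ⟨N, hN1, hN2⟩ := ((eventually_form_self_pos hx y).and
      (eventually_linear_pos (form_weylVector_pos hx hd) (y ⬝ₑ weylVector))).exists
    obtain ⟨g', hg', hfix, hdom⟩ := exists_dominant {i | x ⬝ₑ simpleRoot i = 0} (N • x + y) hN1
      (by rwa [form_add_left, form_smul_left])
    have hx' : g' x = x := hfix x fun _ h => h
    have hdom' : ∀ i, x ⬝ₑ simpleRoot i = 0 → 0 ≤ g' y ⬝ₑ simpleRoot i := fun i hi => by
      have := hdom i hi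
      rwa [map_add, map_smul, hx', form_add_left, form_smul_left, hi, mul_zero, zero_add] at this
    have hev : ∀ᶠ N : ℤ in Filter.atTop, ∀ i, x ⬝ₑ simpleRoot i ≠ 0 →
        0 < (N • x + g' y) ⬝ₑ simpleRoot i := by
      refine Filter.eventually_all.2 fun i => ?_
      by_cases hi : x ⬝ₑ simpleRoot i = 0
      · exact Filter.Eventually.of_forall fun _ h => absurd hi h
      · filter_upwards [eventually_linear_pos ((hd i).lt_of_ne' hi) (g' y ⬝ₑ simpleRoot i)]
          with N h _
        rwa [form_add_left, form_smul_left]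
    obtain ⟨M, hM1, hM2⟩ := ((eventually_form_self_pos hx (g' y)).and hev).exists
    refine Nat.find_min hex (m := (Finset.univ.filter fun i =>
      (M • x + g' y) ⬝ₑ simpleRoot i = 0).card) ?_
      ⟨g' ∘ₗ g, M • x + g' y, hg'.comp hg, hM1, fun i => ?_, fun r hr => ?_, rfl⟩
    · rw [← hn]
      have hval : ∀ i, x ⬝ₑ simpleRoot i = 0 →
          (M • x + g' y) ⬝ₑ simpleRoot i = g' y ⬝ₑ simpleRoot i := fun i hi => by
        rw [form_add_left, form_smul_left, hi, mul_zero, zero_add]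
      refine Finset.card_lt_card (Finset.ssubset_iff_subset_ne.2 ⟨fun i hi => ?_, fun heq => ?_⟩)
      · simp only [Finset.mem_filter, Finset.mem_univ, true_and] at hi ⊢
        by_contra h
        exact (hM2 i h).ne' hi
      · have hy' : g' (g' y) = g' y := hfix _ fun i hi => by
          have : i ∈ Finset.univ.filter fun i => (M • x + g' y) ⬝ₑ simpleRoot i = 0 := by
            rw [heq]; simpa using hi
          rw [← hval i hi]
          simpa using this
        have : j ∈ Finset.univ.filter fun i => (M • x + g' y) ⬝ₑ simpleRoot i = 0 := by
          rw [heq]; simpa using hj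
        rw [hg'.injective hy'] at this
        have hz : (M • x + y) ⬝ₑ simpleRoot j = 0 := by simpa using this
        rw [form_add_left, form_smul_left, hj, mul_zero, zero_add] at hz
        exact hyj hz
    · by_cases hi : x ⬝ₑ simpleRoot i = 0
      · rw [form_add_left, form_smul_left, hi, mul_zero, zero_add]
        exact hdom' i hi
      · exact (hM2 i hi).le
    · have h1 : g' (g r) ⬝ₑ x = 0 := by
        conv_lhs => rw [← hx', hg', ho r hr]
      rw [LinearMap.comp_apply, form_add_right, form_smul_right, h1, hg', form_comm,
        hy _ ⟨r, hr, rfl⟩, mul_zero, zero_add]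

theorem form_eq_zero_of_supported {A B : List (Fin 10)} (hAB : ∀ a ∈ A, ∀ b ∈ B, e10Gram a b = 0)
    {x y : E10} (hx : ∀ i ∉ A, x i = 0) (hy : ∀ i ∉ B, y i = 0) : x ⬝ₑ y = 0 := by
  rw [form_eq_double_sum]
  refine Finset.sum_eq_zero fun i _ => Finset.sum_eq_zero fun j _ => ?_
  by_cases hi : i ∈ A
  · by_cases hj : j ∈ B
    · simp [hAB i hi j hj]
    · simp [hy j hj]
  · simp [hx i hi]

theorem IsSupportedOn.disjoint_or_disjoint {R : Submodule ℤ E10} (hR : IsIrreducibleRootLattice R)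
    {x : E10} (hx : 0 < x ⬝ₑ x) {J : Set (Fin 10)} (hJx : ∀ i ∈ J, x ⬝ₑ simpleRoot i = 0)
    (hJ : IsSupportedOn R J) {A B : List (Fin 10)} (hJAB : ∀ i ∈ J, i ∈ A ∨ i ∈ B)
    (hAB : ∀ a ∈ A, ∀ b ∈ B, e10Gram a b = 0) : (∀ i ∈ A, i ∉ J) ∨ ∀ i ∈ B, i ∉ J := by
  have hdisj : ∀ a ∈ A, a ∉ B := fun a ha hb => by
    have h := hAB a ha a hb
    have h2 := simpleRoot_form_self a
    rw [form_simpleRoot_simpleRoot] at h2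
    omega
  have key : ∀ r ∈ R, r ⬝ₑ r = -2 → (∀ i ∉ A, r i = 0) ∨ ∀ i ∈ A, r i = 0 := by
    intro r hr hrr
    have hrJ : ∀ i ∉ J, r i = 0 := fun i hi => hJ.apply_eq_zero r hr i hi
    let rA : E10 := fun i => if i ∈ A then r i else 0
    let rB : E10 := fun i => if i ∈ A then 0 else r i
    have hsum : r = rA + rB := by
      ext i; by_cases hi : i ∈ A <;> simp [rA, rB, hi]
    have hAx : x ⬝ₑ rA = 0 := by
      rw [form_comm, form_eq_sum]
      refine Finset.sum_eq_zero fun i _ => ?_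
      by_cases hi : i ∈ J
      · simp [hJx i hi]
      · simp [rA, hrJ i hi]
    have hBx : x ⬝ₑ rB = 0 := by
      rw [form_comm, form_eq_sum]
      refine Finset.sum_eq_zero fun i _ => ?_
      by_cases hi : i ∈ J
      · simp [hJx i hi]
      · simp [rB, hrJ i hi]
    have hAB0 : rA ⬝ₑ rB = 0 := by
      refine form_eq_zero_of_supported hAB (fun i hi => by simp [rA, hi]) fun i hi => ?_
      by_cases hiA : i ∈ A
      · simp [rB, hiA]
      · have : i ∉ J := fun h => by
          have := hJAB i h
          simp [hi, hiA] at this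
        simp [rB, hrJ i this]
    by_cases hA : rA = 0
    · right
      intro i hi
      simpa [rA, hi] using congrFun hA i
    by_cases hB : rB = 0
    · left
      intro i hi
      simpa [rB, hi] using congrFun hB i
    have h1 := form_self_neg_of_orthogonal hx hAx hA
    have h2 := form_self_neg_of_orthogonal hx hBx hB
    have h3 := two_dvd_form_self rA
    have h4 := two_dvd_form_self rB
    rw [hsum, form_add_left, form_add_right, form_add_right, form_comm rB, hAB0] at hrr
    omega
  have hB : ∀ r ∈ R, (∀ i ∈ A, r i = 0) → ∀ i ∉ B, r i = 0 := fun r hr h i hi => by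
    by_cases hiA : i ∈ A
    · exact h i hiA
    · refine hJ.apply_eq_zero r hr i fun hiJ => ?_
      have := hJAB i hiJ
      simp [hi, hiA] at this
  rcases hR.irreducible (fun r => ∀ i ∉ A, r i = 0) fun s hs hss t ht htt h1 h2 =>
    form_eq_zero_of_supported hAB h1 (hB t ht ((key t ht htt).resolve_left h2)) with h | h
  · right
    intro j hjB hj
    have hle : R ≤ LinearMap.ker (formRight (simpleRoot j)) :=
      hR.induction fun r hr hrr => form_eq_zero_of_supported hAB (h r hr hrr) fun i hi => by
        rw [simpleRoot, Pi.single_eq_of_ne]; rintro rfl; exact hi hjB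
    have := hJ.full (simpleRoot j) (fun r hr => (form_comm _ _).trans (hle hr)) j hj
    rw [simpleRoot_form_self] at this
    omega
  · left
    intro j hjA hj
    have hle : R ≤ LinearMap.ker (formRight (simpleRoot j)) :=
      hR.induction fun r hr hrr => by
        refine (form_comm _ _).trans (form_eq_zero_of_supported hAB (fun i hi => ?_)
          (hB r hr ((key r hr hrr).resolve_left (h r hr hrr))))
        rw [simpleRoot, Pi.single_eq_of_ne]; rintro rfl; exact hi hjA
    have := hJ.full (simpleRoot j) (fun r hr => (form_comm _ _).trans (hle hr)) j hj
    rw [simpleRoot_form_self] at this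
    omega

/-- A node of the `E₁₀` diagram, and two unions of branches at that node covering the others. -/
def diagramCuts : List (Fin 10 × List (Fin 10) × List (Fin 10)) :=
  [(1, [0], [2, 3, 4, 5, 6, 7, 8, 9]), (2, [0, 1], [3, 4, 5, 6, 7, 8, 9]),
    (3, [0, 1, 2], [4, 5, 6, 7, 8, 9]), (4, [0, 1, 2, 3], [5, 6, 7, 8, 9]),
    (5, [0, 1, 2, 3, 4], [6, 7, 8, 9]), (6, [9], [0, 1, 2, 3, 4, 5, 7, 8]),
    (6, [7, 8], [0, 1, 2, 3, 4, 5, 9]), (7, [8], [0, 1, 2, 3, 4, 5, 6, 9])]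

/-- Sets of nodes for which the root lattice can be moved into a copy of `E₈`. -/
def splitSubdiagrams : List (List (Fin 10)) :=
  [[2, 3, 4, 5, 6, 7, 8, 9], [0, 1, 2, 3, 4, 5, 6], [1, 2, 3, 4, 5, 6, 7], [1, 2, 3, 4, 5, 6, 9]]

/-- The remaining connected subdiagrams of finite type: types `A₈`, `D₈`, `D₉`, `A₉`. -/
def largeSubdiagrams : List (List (Fin 10)) :=
  [[0, 1, 2, 3, 4, 5, 6, 7], [1, 2, 3, 4, 5, 6, 7, 8], [0, 1, 2, 3, 4, 5, 6, 9],
    [1, 2, 3, 4, 5, 6, 7, 9], [0, 1, 2, 3, 4, 5, 6, 7, 9], [0, 1, 2, 3, 4, 5, 6, 7, 8]]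

theorem diagramCuts_spec : diagramCuts.all (fun c =>
    (List.finRange 10).all (fun i => i == c.1 || c.2.1.contains i || c.2.2.contains i) &&
      c.2.1.all fun a => c.2.2.all fun b => e10Gram a b == 0) = true := by
  decide +kernel

/-- A set of nodes, given by its indicator function, is proper and is connected as far as
`diagramCuts` can tell only if it is one of those listed. -/
def subdiagramCheck (f : Fin 10 → Bool) : Bool :=
  !((List.finRange 10).any (fun k => !f k && k != 0) &&
    diagramCuts.all fun c => f c.1 || c.2.1.all (fun i => !f i) || c.2.2.all fun i => !f i) ||
  splitSubdiagrams.any (fun K => (List.finRange 10).all fun i => !f i || K.contains i) ||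
  largeSubdiagrams.any fun K => (List.finRange 10).all fun i => f i == K.contains i

theorem subdiagramCheck_vec : ∀ b0 b1 b2 b3 b4 b5 b6 b7 b8 b9 : Bool,
    subdiagramCheck ![b0, b1, b2, b3, b4, b5, b6, b7, b8, b9] = true := by
  decide +kernel

theorem subdiagramCheck_eq_true (f : Fin 10 → Bool) : subdiagramCheck f = true := by
  convert subdiagramCheck_vec (f 0) (f 1) (f 2) (f 3) (f 4) (f 5) (f 6) (f 7) (f 8) (f 9)
  ext i; fin_cases i <;> rfl

theorem IsSupportedOn.subdiagram {R : Submodule ℤ E10} (hR : IsIrreducibleRootLattice R)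
    {x : E10} (hx : 0 < x ⬝ₑ x) {J : Set (Fin 10)} (hJx : ∀ i, i ∈ J ↔ x ⬝ₑ simpleRoot i = 0)
    (hJ : IsSupportedOn R J) : (∃ K ∈ splitSubdiagrams, ∀ i ∈ J, i ∈ K) ∨
      ∃ K ∈ largeSubdiagrams, ∀ i, i ∈ J ↔ i ∈ K := by
  classical
  have h := subdiagramCheck_eq_true fun i => decide (i ∈ J)
  simp only [subdiagramCheck, Bool.or_eq_true, Bool.not_eq_true', Bool.and_eq_false_iff,
    List.any_eq_true, List.all_eq_true, List.any_eq_false, List.all_eq_false] at h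
  rcases h with ((h | ⟨c, hc, h⟩) | ⟨K, hK, h⟩) | ⟨K, hK, h⟩
  · have h' : ∀ k, k ≠ 0 → x ⬝ₑ simpleRoot k = 0 := fun k hk => by
      have := h k (List.mem_finRange k)
      simp only [Bool.and_eq_true, bne_iff_ne, ne_eq, hk, not_false_eq_true, and_true,
        Bool.not_eq_true', decide_eq_false_iff_not, not_not] at this
      exact (hJx k).1 this
    have hxw : x = (x ⬝ₑ simpleRoot 0) • weight 0 := by
      conv_lhs => rw [eq_sum_weight x]
      rw [Finset.sum_eq_single 0 (fun k _ hk => by rw [h' k hk, zero_smul]) (by simp)]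
    have hw : weight 0 ⬝ₑ weight 0 = 0 := by rw [form_weight]; rfl
    rw [hxw, form_smul_left, form_smul_right, hw] at hx
    simp at hx
  · have hs := List.all_eq_true.1 diagramCuts_spec c hc
    simp only [Bool.and_eq_true, List.all_eq_true, List.mem_finRange, true_imp_iff,
      Bool.or_eq_true, beq_iff_eq, List.contains_iff_mem] at hs
    simp only [decide_eq_true_eq, decide_eq_false_iff_not, not_or] at h
    obtain ⟨⟨h1, h2⟩, h3⟩ := h
    rcases hJ.disjoint_or_disjoint hR hx (fun i hi => (hJx i).1 hi) (A := c.2.1) (B := c.2.2)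
      (fun i hi => (or_assoc.1 (hs.1 i)).resolve_left fun h => h1 (h ▸ hi)) hs.2 with h | h
    exacts [(h2 h).elim, (h3 h).elim]
  · refine .inl ⟨K, hK, fun i hi => ?_⟩
    simpa [hi] using h i (List.mem_finRange i)
  · refine .inr ⟨K, hK, fun i => ?_⟩
    have := h i (List.mem_finRange i)
    rwa [beq_iff_eq, Bool.eq_iff_iff, decide_eq_true_eq, List.contains_iff_mem] at this

/-! ### Lifting isometries modulo two -/

/-- Every isometry of `E₁₀ ⊗ F₂` fixing `R̄` pointwise and preserving the reduction of `R^⊥`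
lifts to an isometry of `E₁₀` fixing `R` pointwise. -/
def IsLiftable (R : Submodule ℤ E10) : Prop :=
  ∀ h : V10 →ₗ[ZMod 2] V10, PreservesQ h → (∀ r ∈ R, h (red r) = red r) →
    (∀ x, (∀ r ∈ R, x ⬝ₑ r = 0) → ∃ y, (∀ r ∈ R, y ⬝ₑ r = 0) ∧ red y = h (red x)) →
    ∃ g : E10 →ₗ[ℤ] E10, PreservesForm g ∧ (∀ r ∈ R, g r = r) ∧ ∀ x, red (g x) = h (red x)

theorem IsLiftable.of_map {R : Submodule ℤ E10} {g : E10 →ₗ[ℤ] E10} (hg : PreservesForm g)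
    (hR : IsLiftable (R.map g)) : IsLiftable R := by
  intro h hq hfix hperp
  obtain ⟨e, rfl⟩ := hg.exists_equiv
  obtain ⟨k, hk, hek⟩ := hg.exists_reduction
  have hek' : ∀ x, red (e.symm x) = k.symm (red x) := fun x => by
    rw [LinearEquiv.eq_symm_apply, ← hek, LinearEquiv.apply_symm_apply]
  have hke : ∀ x, k.symm (red (e x)) = red x := fun x => by rw [hek, LinearEquiv.symm_apply_apply]
  obtain ⟨g', hg', hfix', hred⟩ := hR ((k : V10 →ₗ[ZMod 2] V10) ∘ₗ h ∘ₗ k.symm)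
    (fun v => by
      have h1 := hk (h (k.symm v))
      have h2 := hk (k.symm v)
      have h3 := hq (k.symm v)
      simp only [LinearEquiv.coe_coe, LinearEquiv.apply_symm_apply] at h1 h2
      simp only [LinearMap.comp_apply, LinearEquiv.coe_coe, h1, h2, h3])
    (by
      rintro _ ⟨r, hr, rfl⟩
      simp only [LinearMap.comp_apply, LinearEquiv.coe_coe, LinearEquiv.symm_apply_apply,
        hfix r hr, hek])
    (fun x hx => by
      obtain ⟨y, hy, hyx⟩ := hperp (e.symm x) fun r hr => by
        have := hx (e r) ⟨r, hr, rfl⟩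
        rwa [← e.apply_symm_apply x, show e (e.symm x) ⬝ₑ e r = _ from hg _ _] at this
      refine ⟨e y, ?_, ?_⟩
      · rintro _ ⟨r, hr, rfl⟩
        exact (hg y r).trans (hy r hr)
      · simp only [LinearMap.comp_apply, LinearEquiv.coe_coe, hek, hyx, hek'])
  refine ⟨e.symm ∘ₗ g' ∘ₗ e, hg.symm.comp (hg'.comp hg), fun r hr => ?_, fun x => ?_⟩
  · simp only [LinearMap.comp_apply, LinearEquiv.coe_coe]
    rw [show g' (e r) = e r from hfix' (e r) ⟨r, hr, rfl⟩, LinearEquiv.symm_apply_apply]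
  · simp only [LinearMap.comp_apply, LinearEquiv.coe_coe, hek', hred, hke,
      LinearEquiv.symm_apply_apply]

theorem exists_half_formRight {F : E10 →ₗ[ℤ] ℤ} (hF : ∀ x, 2 ∣ F x) :
    ∃ t, ∀ x, F x = 2 * (x ⬝ₑ t) := by
  choose c hc using fun i => hF (simpleRoot i)
  refine ⟨∑ i, c i • weight i, fun x => ?_⟩
  conv_lhs => rw [eq_sum_simpleRoot x]
  simp only [map_sum, map_smul, hc, form_sum_right, form_smul_right, form_weight, smul_eq_mul,
    Finset.mul_sum]
  exact Finset.sum_congr rfl fun i _ => by ring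

theorem exists_projection_primitiveClosure {R R' : Submodule ℤ E10}
    (hR' : ∀ x, x ∈ R' ↔ ∃ c : ℤ, c ≠ 0 ∧ c • x ∈ R) :
    ∃ p : E10 →ₗ[ℤ] E10, (∀ x, p x ∈ R') ∧ ∀ x ∈ R', p x = x := by
  have htf : Module.IsTorsionFree ℤ (E10 ⧸ R') := by
    refine Module.IsTorsionFree.of_smul_eq_zero fun c m hm => ?_
    induction m using Submodule.Quotient.induction_on with
    | _ x =>
      by_cases hc : c = 0
      · exact .inl hc
      · right
        rw [← Submodule.Quotient.mk_smul, Submodule.Quotient.mk_eq_zero, hR'] at hm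
        obtain ⟨d, hd, hdx⟩ := hm
        rw [Submodule.Quotient.mk_eq_zero, hR']
        exact ⟨d * c, mul_ne_zero hd hc, by rwa [mul_smul]⟩
  obtain ⟨s, hs⟩ := Module.projective_lifting_property R'.mkQ LinearMap.id R'.mkQ_surjective
  refine ⟨LinearMap.id - s ∘ₗ R'.mkQ, fun x => ?_, fun x hx => ?_⟩
  · rw [← Submodule.Quotient.mk_eq_zero, ← Submodule.mkQ_apply]
    have := LinearMap.congr_fun hs (R'.mkQ x)
    simp only [LinearMap.comp_apply, LinearMap.id_apply] at this
    simp only [LinearMap.sub_apply, LinearMap.id_apply, LinearMap.comp_apply, map_sub, this,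
      sub_self]
  · have : R'.mkQ x = 0 := by rwa [Submodule.mkQ_apply, Submodule.Quotient.mk_eq_zero]
    simp only [LinearMap.sub_apply, LinearMap.id_apply, LinearMap.comp_apply, this, map_zero,
      sub_zero]

theorem preserves_red_orthogonal {R R' : Submodule ℤ E10}
    (hR' : ∀ x, x ∈ R' ↔ ∃ c : ℤ, c ≠ 0 ∧ c • x ∈ R) {h : V10 →ₗ[ZMod 2] V10} (hq : PreservesQ h)
    (himg : red '' (R' : Set E10) ⊆ h '' (red '' (R' : Set E10))) {x : E10}
    (hx : ∀ r ∈ R, x ⬝ₑ r = 0) : ∃ y, (∀ r ∈ R, y ⬝ₑ r = 0) ∧ red y = h (red x) := by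
  have hx' : ∀ r ∈ R', x ⬝ₑ r = 0 := fun r hr => by
    obtain ⟨c, hc, hcr⟩ := (hR' r).1 hr
    have := hx _ hcr
    rw [form_smul_right] at this
    exact (mul_eq_zero.1 this).resolve_left hc
  obtain ⟨z, hz⟩ := red_surjective (h (red x))
  obtain ⟨p, hp, hpR⟩ := exists_projection_primitiveClosure hR'
  have heven : ∀ r ∈ R', 2 ∣ r ⬝ₑ z := fun r hr => by
    obtain ⟨_, ⟨s, hs, rfl⟩, hsr⟩ := himg ⟨r, hr, rfl⟩
    have := form_lift_parity hq hz hsr.symm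
    rwa [hx' s hs, sub_zero, form_comm] at this
  obtain ⟨t, ht⟩ := exists_half_formRight (F := formRight z ∘ₗ p) fun y => heven _ (hp y)
  refine ⟨z - (2 : ℤ) • t, fun r hr => ?_, ?_⟩
  · have hrR' : r ∈ R' := (hR' r).2 ⟨1, one_ne_zero, by rwa [one_smul]⟩
    have := ht r
    rw [LinearMap.comp_apply, hpR r hrR', formRight_apply] at this
    rw [form_sub_left, form_smul_left, form_comm z, form_comm t, this, sub_self]
  · rw [← hz, red_eq_red_iff]
    exact ⟨-t, by rw [smul_neg, sub_eq_add_neg]⟩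

/-! ### The roots of the orthogonal complement of the hyperbolic plane -/

/-- The positive roots of the `E₈` sublattice spanned by the last eight simple roots, each encoded
by the decimal digits of its coordinates. -/
def e8RootCodes : List ℕ :=
  [10000000, 1000000, 100000, 10000, 1000, 100, 10, 1, 1100000, 10010000, 110000, 11000, 1100,
   110, 11, 10110000, 1110000, 10011000, 111000, 11100, 1110, 111, 11110000, 10111000, 1111000,
   10011100, 111100, 11110, 1111, 11111000, 10121000, 10111100, 1111100, 10011110, 111110, 11111,
   11121000, 11111100, 10121100, 10111110, 1111110, 10011111, 111111, 11221000, 11121100,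
   10122100, 11111110, 10121110, 10111111, 1111111, 11221100, 11122100, 11121110, 10122110,
   11111111, 10121111, 11222100, 11221110, 11122110, 10122210, 11121111, 10122111, 11232100,
   11222110, 11122210, 11221111, 11122111, 10122211, 21232100, 11232110, 11222210, 11222111,
   11122211, 10122221, 21232110, 11232210, 11232111, 11222211, 11122221, 21232210, 11233210,
   21232111, 11232211, 11222221, 21233210, 21232211, 11233211, 11232221, 21243210, 21233211,
   21232221, 11233221, 21343210, 21243211, 21233221, 11233321, 22343210, 21343211, 21243221,
   21233321, 22343211, 21343221, 21243321, 22343221, 21343321, 21244321, 22343321, 21344321,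
   22344321, 21354321, 31354321, 22354321, 32354321, 22454321, 32454321, 32464321, 32465321,
   32465421, 32465431, 32465432]

/-- The vector encoded by a list of decimal digits. -/
def e8Root (c : ℕ) : E10 := fun i => if i.val < 2 then 0 else ((c / 10 ^ (i.val - 2) % 10 : ℕ) : ℤ)

theorem e8Root_form_self : ∀ c ∈ e8RootCodes, e8Root c ⬝ₑ e8Root c = -2 := by decide +kernel

theorem exists_e8Root_aux : ∀ a b c d e f g k : ZMod 2, q2 ![0, 0, a, b, c, d, e, f, g, k] = 1 →
    ∃ n ∈ e8RootCodes, red (e8Root n) = ![0, 0, a, b, c, d, e, f, g, k] := by decide +kernel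

theorem exists_root_red_eq {w : V10} (h0 : w 0 = 0) (h1 : w 1 = 0) (hq : q2 w = 1) :
    ∃ r, r 0 = 0 ∧ r 1 = 0 ∧ r ⬝ₑ r = -2 ∧ red r = w := by
  have hw : w = ![0, 0, w 2, w 3, w 4, w 5, w 6, w 7, w 8, w 9] := by
    ext i; fin_cases i <;> simp [h0, h1]
  obtain ⟨n, hn, hr⟩ := exists_e8Root_aux (w 2) (w 3) (w 4) (w 5) (w 6) (w 7) (w 8) (w 9)
    (by rwa [← hw])
  exact ⟨e8Root n, rfl, rfl, e8Root_form_self n hn, hr.trans hw.symm⟩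

/-- The primitive null vector orthogonal to all simple roots but the first. -/
abbrev nullRoot : E10 := weight 0

theorem form_nullRoot_add (x : E10) : x ⬝ₑ (simpleRoot 0 + nullRoot) = x 1 - x 0 := by
  rw [form_add_right, form_weight, form_explicit]
  simp [simpleRoot]
  ring

theorem form_self_neg_of_e8 {x : E10} (h1 : x 1 = 0) (hx : x ≠ 0) : x ⬝ₑ x < 0 := by
  by_contra! h
  exact hx (form_self_of_coord_one_eq_zero h1 h)

theorem abs_form_le_one {r s : E10} (hr1 : r 1 = 0) (hs1 : s 1 = 0) (hr : r ⬝ₑ r = -2)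
    (hs : s ⬝ₑ s = -2) (hne : red r ≠ red s) : r ⬝ₑ s ≤ 1 ∧ -1 ≤ r ⬝ₑ s := by
  have h1 := form_self_neg_of_e8 (x := r + s) (by simp [hr1, hs1]) fun h => hne <|
    red_eq_red_iff.2 ⟨-s, by rw [eq_neg_of_add_eq_zero_left h]; module⟩
  have h2 := form_self_neg_of_e8 (x := r - s) (by simp [hr1, hs1]) fun h => hne <| by
    rw [sub_eq_zero.1 h]
  simp only [form_add_left, form_add_right, form_sub_left, form_sub_right, hr, hs,
    form_comm s r] at h1 h2
  omega

theorem eq_or_eq_neg_of_red_eq {r s : E10} (hr1 : r 1 = 0) (hs1 : s 1 = 0) (hr : r ⬝ₑ r = -2)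
    (hs : s ⬝ₑ s = -2) (h : red r = red s) : r = s ∨ r = -s := by
  obtain ⟨z, rfl⟩ := red_eq_red_iff.1 h
  have hz1 : z 1 = 0 := by simpa [hs1] using hr1
  by_contra! hne
  have h1 := form_self_neg_of_e8 (x := z) hz1 fun h => hne.1 <| by rw [h, smul_zero, add_zero]
  have h2 := form_self_neg_of_e8 (x := s + z) (by simp [hs1, hz1]) fun h => hne.2 <| by
    rw [eq_neg_of_add_eq_zero_right h]; module
  obtain ⟨c, hc⟩ := two_dvd_form_self z
  obtain ⟨d, hd⟩ := two_dvd_form_self (s + z)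
  simp only [form_add_left, form_add_right, form_smul_left, form_smul_right, hs,
    form_comm z s] at hr hd h2
  omega

/-! ### Lattices orthogonal to the hyperbolic plane -/

theorem exists_signs (ε : Fin 10 → Fin 10 → ℤˣ) :
    ∃ s : Fin 10 → ℤˣ, ∀ i j, i < j → e10Gram i j = 1 → s i * s j = ε i j := by
  have edges : ∀ i j : Fin 10, i < j → e10Gram i j = 1 → (i, j) ∈
      [((0 : Fin 10), (1 : Fin 10)), (1, 2), (2, 3), (3, 4), (4, 5), (5, 6), (6, 7), (7, 8),
        (6, 9)] := by
    simp only [e10Gram, of_apply]; decide +kernel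
  refine ⟨![1, ε 0 1, ε 0 1 * ε 1 2, ε 0 1 * ε 1 2 * ε 2 3, ε 0 1 * ε 1 2 * ε 2 3 * ε 3 4,
    ε 0 1 * ε 1 2 * ε 2 3 * ε 3 4 * ε 4 5, ε 0 1 * ε 1 2 * ε 2 3 * ε 3 4 * ε 4 5 * ε 5 6,
    ε 0 1 * ε 1 2 * ε 2 3 * ε 3 4 * ε 4 5 * ε 5 6 * ε 6 7,
    ε 0 1 * ε 1 2 * ε 2 3 * ε 3 4 * ε 4 5 * ε 5 6 * ε 6 7 * ε 7 8,
    ε 0 1 * ε 1 2 * ε 2 3 * ε 3 4 * ε 4 5 * ε 5 6 * ε 6 9], fun i j hij hg => ?_⟩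
  have := edges i j hij hg
  simp only [List.mem_cons, Prod.mk.injEq, List.not_mem_nil, or_false] at this
  have key : ∀ a b : ℤˣ, a * (a * b) = b := fun a b => by
    rw [← mul_assoc, Int.units_mul_self, one_mul]
  rcases this with h | h | h | h | h | h | h | h | h <;> obtain ⟨rfl, rfl⟩ := h
  · exact one_mul _
  all_goals exact key _ _

theorem eq_smul_nullRoot_add (x : E10) :
    x = x 1 • nullRoot + ∑ i, (x i - x 1 * nullRoot i) • simpleRoot i := by
  have h : x 1 • nullRoot = ∑ i, (x 1 * nullRoot i) • simpleRoot i := by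
    conv_lhs => rw [eq_sum_simpleRoot nullRoot]
    simp only [Finset.smul_sum, mul_smul]
  rw [h, ← Finset.sum_add_distrib]
  conv_lhs => rw [eq_sum_simpleRoot x]
  exact Finset.sum_congr rfl fun i _ => by rw [← add_smul, add_sub_cancel]

theorem exists_preservesForm_fixing_nullRoot {r : Fin 10 → E10}
    (hr : ∀ i j, i ≠ 1 → j ≠ 1 → r i ⬝ₑ r j = e10Gram i j)
    (hn : ∀ i, i ≠ 1 → r i ⬝ₑ nullRoot = simpleRoot i ⬝ₑ nullRoot) :
    ∃ g : E10 →ₗ[ℤ] E10, PreservesForm g ∧ ∀ x,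
      g x = x 1 • nullRoot + ∑ i, (x i - x 1 * nullRoot i) • r i := by
  let c : E10 → Fin 10 → ℤ := fun x i => x i - x 1 * nullRoot i
  have hc : ∀ x, c x 1 = 0 := fun x => by
    simp [c, show nullRoot 1 = 1 by decide +kernel]
  have hnn : nullRoot ⬝ₑ nullRoot = 0 := by decide +kernel
  have hx : ∀ x : E10, x = x 1 • nullRoot + ∑ i, c x i • simpleRoot i := eq_smul_nullRoot_add
  let g : E10 →ₗ[ℤ] E10 := (LinearMap.proj 1).smulRight nullRoot +
    ∑ i, LinearMap.smulRight (LinearMap.proj i - nullRoot i • LinearMap.proj 1 : E10 →ₗ[ℤ] ℤ) (r i)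
  have hg : ∀ x, g x = x 1 • nullRoot + ∑ i, c x i • r i := fun x => by
    simp only [g, c, LinearMap.add_apply, LinearMap.smulRight_apply, LinearMap.proj_apply,
      LinearMap.sum_apply, LinearMap.sub_apply, LinearMap.smul_apply, smul_eq_mul,
      mul_comm (nullRoot _)]
  refine ⟨g, fun x y => ?_, hg⟩
  conv_rhs => rw [hx x, hx y]
  rw [hg, hg]
  simp only [form_add_left, form_add_right, form_smul_left, form_smul_right, form_sum_left,
    form_sum_right, hnn, form_comm nullRoot]
  have h1 : ∀ z i (d : ℤ), c z i * (d * (r i ⬝ₑ nullRoot)) =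
      c z i * (d * (simpleRoot i ⬝ₑ nullRoot)) := fun z i d => by
    by_cases hi : i = 1
    · simp [hi, hc]
    · rw [hn i hi]
  have h2 : ∀ i j, c x i * (c y j * (r i ⬝ₑ r j)) =
      c x i * (c y j * (simpleRoot i ⬝ₑ simpleRoot j)) := fun i j => by
    by_cases hi : i = 1
    · simp [hi, hc]
    by_cases hj : j = 1
    · simp [hj, hc]
    rw [hr i j hi hj, form_simpleRoot_simpleRoot]
  have h3 : ∀ i j, c y i * (c x j * (r j ⬝ₑ r i)) =
      c y i * (c x j * (simpleRoot j ⬝ₑ simpleRoot i)) := fun i j => by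
    rw [mul_left_comm, h2, mul_left_comm]
  have h0 : ∀ z i, c z i * (r i ⬝ₑ nullRoot) = c z i * (simpleRoot i ⬝ₑ nullRoot) := fun z i => by
    simpa using h1 z i 1
  simp only [mul_add, Finset.mul_sum, h0, h1, h3]

theorem PreservesQ.injective {h : V10 →ₗ[ZMod 2] V10} (hq : PreservesQ h) :
    Function.Injective h := by
  refine (injective_iff_map_eq_zero h).2 fun v hv => ?_
  obtain ⟨x, rfl⟩ := red_surjective v
  ext i
  obtain ⟨y, hy⟩ := red_surjective (h (red (weight i)))
  have := form_lift_parity hq (x' := 0) (by rw [hv, red_zero]) hy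
  rw [form_zero_left, form_weight, zero_sub, dvd_neg] at this
  exact (ZMod.intCast_zmod_eq_zero_iff_dvd _ 2).2 this

theorem red_sum {ι : Type*} (s : Finset ι) (f : ι → E10) :
    red (∑ i ∈ s, f i) = ∑ i ∈ s, red (f i) :=
  map_sum (⟨⟨red, red_zero⟩, red_add⟩ : E10 →+ V10) f s

theorem form_simpleRoot_zero (x : E10) : x ⬝ₑ simpleRoot 0 = x 1 - 2 * x 0 := by
  have := form_nullRoot_add x
  rw [form_add_right, form_weight] at this
  linarith

theorem PreservesQ.exists_root_lift {h : V10 →ₗ[ZMod 2] V10} (hq : PreservesQ h)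
    (h0 : h (red (simpleRoot 0)) = red (simpleRoot 0)) (hn : h (red nullRoot) = red nullRoot)
    {i : Fin 10} (hi0 : i ≠ 0) (hi1 : i ≠ 1) :
    ∃ r, r 0 = 0 ∧ r 1 = 0 ∧ r ⬝ₑ r = -2 ∧ red r = h (red (simpleRoot i)) := by
  obtain ⟨z, hz⟩ := red_surjective (h (red (simpleRoot i)))
  have e0 : simpleRoot i 0 = 0 := Pi.single_eq_of_ne hi0.symm _
  have e1 : simpleRoot i 1 = 0 := Pi.single_eq_of_ne hi1.symm _
  have p0 := form_lift_parity hq hz hn.symm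
  have p1 := form_lift_parity hq hz h0.symm
  rw [form_weight, form_weight, e0] at p0
  rw [form_simpleRoot_zero, form_simpleRoot_zero, e0, e1] at p1
  refine exists_root_red_eq ?_ ?_ ?_
  · rw [← hz]
    exact (ZMod.intCast_zmod_eq_zero_iff_dvd _ 2).2 (by push_cast; omega)
  · rw [← hz]
    exact (ZMod.intCast_zmod_eq_zero_iff_dvd _ 2).2 (by push_cast; omega)
  · rw [hq, q2_eq_one_iff, simpleRoot_form_self]
    decide

theorem exists_lift_of_fixes_plane {h : V10 →ₗ[ZMod 2] V10} (hq : PreservesQ h)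
    (h0 : h (red (simpleRoot 0)) = red (simpleRoot 0)) (hn : h (red nullRoot) = red nullRoot) :
    ∃ g : E10 →ₗ[ℤ] E10, PreservesForm g ∧ g (simpleRoot 0) = simpleRoot 0 ∧
      g nullRoot = nullRoot ∧ ∀ x, red (g x) = h (red x) := by
  classical
  choose! r hr0 hr1 hrr hred using
    fun i (hi : i ≠ 0 ∧ i ≠ 1) => hq.exists_root_lift h0 hn hi.1 hi.2
  obtain ⟨s, hs⟩ := exists_signs fun i j => if r i ⬝ₑ r j = 1 then 1 else -1
  have hlt : ∀ i j, i ≠ 0 → i ≠ 1 → j ≠ 0 → j ≠ 1 → i < j →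
      (s i : ℤ) * (s j * (r i ⬝ₑ r j)) = e10Gram i j := fun i j hi0 hi1 hj0 hj1 hij => by
    have hp := form_lift_parity hq (hred i ⟨hi0, hi1⟩) (hred j ⟨hj0, hj1⟩)
    have hb := abs_form_le_one (hr1 i ⟨hi0, hi1⟩) (hr1 j ⟨hj0, hj1⟩) (hrr i ⟨hi0, hi1⟩)
      (hrr j ⟨hj0, hj1⟩) fun heq => by
        rw [hred i ⟨hi0, hi1⟩, hred j ⟨hj0, hj1⟩] at heq
        have := congrFun (hq.injective heq) i
        simp [red, simpleRoot, hij.ne] at this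
    have hg : e10Gram i j = 0 ∨ e10Gram i j = 1 :=
      (show ∀ i j : Fin 10, i < j → e10Gram i j = 0 ∨ e10Gram i j = 1 by
        simp only [e10Gram, of_apply]; decide +kernel) i j hij
    rw [form_simpleRoot_simpleRoot] at hp
    rcases hg with hg | hg
    · rw [hg, show r i ⬝ₑ r j = 0 by omega, mul_zero, mul_zero]
    · have hsij := congrArg Units.val (hs i j hij hg)
      rw [Units.val_mul] at hsij
      rw [← mul_assoc, hsij, hg]
      split_ifs with h1
      · rw [h1]; rfl
      · rw [show r i ⬝ₑ r j = -1 by omega]; rfl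
  let R : Fin 10 → E10 := fun i => if i = 0 then simpleRoot 0 else (s i : ℤ) • r i
  have hR0 : R 0 = simpleRoot 0 := if_pos rfl
  have hR : ∀ i, i ≠ 0 → R i = (s i : ℤ) • r i := fun i hi => if_neg hi
  have hunit : ∀ i, (s i : ℤ) * s i = 1 := fun i => by
    rw [← Units.val_mul, Int.units_mul_self, Units.val_one]
  have hRR : ∀ i j, i ≠ 1 → j ≠ 1 → i ≤ j → R i ⬝ₑ R j = e10Gram i j := by
    intro i j hi hj hij
    rcases hij.eq_or_lt with rfl | hij
    · by_cases hi0 : i = 0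
      · rw [hi0, hR0, form_simpleRoot_simpleRoot]
      · rw [hR i hi0, form_smul_left, form_smul_right, ← mul_assoc, hunit, hrr i ⟨hi0, hi⟩,
          ← form_simpleRoot_simpleRoot, simpleRoot_form_self, one_mul]
    · have hj0 : j ≠ 0 := fun h => by simp [h] at hij
      by_cases hi0 : i = 0
      · rw [hi0, hR0, hR j hj0, form_smul_right, form_comm, form_simpleRoot_zero,
          hr0 j ⟨hj0, hj⟩, hr1 j ⟨hj0, hj⟩, ← form_simpleRoot_simpleRoot, form_comm,
          form_simpleRoot_zero]
        simp [simpleRoot, hj0.symm, hj.symm]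
      · rw [hR i hi0, hR j hj0, form_smul_left, form_smul_right, hlt i j hi0 hi hj0 hj hij]
  obtain ⟨g, hg, hgx⟩ := exists_preservesForm_fixing_nullRoot (r := R)
    (fun i j hi hj => by
      rcases le_total i j with hij | hij
      · exact hRR i j hi hj hij
      · rw [form_comm, hRR j i hj hi hij, ← form_simpleRoot_simpleRoot, form_comm,
          form_simpleRoot_simpleRoot])
    (fun i hi => by
      by_cases hi0 : i = 0
      · rw [hi0, hR0]
      · rw [hR i hi0, form_smul_left, form_weight, form_weight, hr0 i ⟨hi0, hi⟩]
        simp [simpleRoot, hi0])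
  have hnull : nullRoot 1 = 1 := by decide +kernel
  refine ⟨g, hg, ?_, ?_, fun x => ?_⟩
  · rw [hgx, Finset.sum_eq_single 0 (fun i _ hi => by simp [simpleRoot, hi]) (by simp), hR0]
    simp [simpleRoot]
  · rw [hgx, hnull, one_smul, Finset.sum_eq_zero fun i _ => by rw [one_mul, sub_self, zero_smul],
      add_zero]
  · rw [hgx]
    conv_rhs => rw [eq_smul_nullRoot_add x]
    simp only [red_add, red_smul, red_sum, map_add, map_sum, map_smul, hn]
    congr 1
    refine Finset.sum_congr rfl fun i _ => ?_
    by_cases hi1 : i = 1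
    · simp [hi1, hnull]
    by_cases hi0 : i = 0
    · rw [hi0, hR0, h0]
    · rw [hR i hi0, red_smul, hred i ⟨hi0, hi1⟩]
      rcases Int.units_eq_one_or (s i) with h | h <;> simp [h, ZMod.neg_eq_self_mod_two]

/-- The second null vector of the hyperbolic plane spanned by `nullRoot` and `simpleRoot 0`. -/
abbrev dualNullRoot : E10 := simpleRoot 0 + nullRoot

theorem nullRoot_form_self : nullRoot ⬝ₑ nullRoot = 0 := by decide +kernel

theorem dualNullRoot_form_self : dualNullRoot ⬝ₑ dualNullRoot = 0 := by decide +kernel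

theorem nullRoot_form_dualNullRoot : nullRoot ⬝ₑ dualNullRoot = 1 := by decide +kernel

theorem dualNullRoot_form_nullRoot : dualNullRoot ⬝ₑ nullRoot = 1 := by decide +kernel

theorem form_smul_add_self {u v : E10} (hu : u ⬝ₑ u = 0) (hv : v ⬝ₑ v = 0) (a : ℤ) :
    (a • u + v) ⬝ₑ (a • u + v) = 2 * a * (u ⬝ₑ v) := by
  simp only [form_add_left, form_add_right, form_smul_left, form_smul_right, hu, hv, form_comm v u]
  ring

/-- Isometries fixing `R` pointwise. -/
structure Stabilizes (R : Submodule ℤ E10) (g : E10 →ₗ[ℤ] E10) : Prop where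
  preservesForm : PreservesForm g
  fixes : ∀ r ∈ R, g r = r

theorem Stabilizes.comp {R : Submodule ℤ E10} {g g' : E10 →ₗ[ℤ] E10} (hg : Stabilizes R g)
    (hg' : Stabilizes R g') : Stabilizes R (g ∘ₗ g') :=
  ⟨hg.1.comp hg'.1, fun r hr => by rw [LinearMap.comp_apply, hg'.2 r hr, hg.2 r hr]⟩

theorem Stabilizes.orthogonal {R : Submodule ℤ E10} {g : E10 →ₗ[ℤ] E10} (hg : Stabilizes R g)
    {x : E10} (hx : ∀ r ∈ R, x ⬝ₑ r = 0) : ∀ r ∈ R, g x ⬝ₑ r = 0 := fun r hr => by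
  rw [← hx r hr, ← hg.1 x r, hg.2 r hr]

theorem stabilizes_eichler {R : Submodule ℤ E10} {u m : E10} {n : ℤ} (hu : u ⬝ₑ u = 0)
    (hm : m ⬝ₑ u = 0) (hn : m ⬝ₑ m = 2 * n) (hRu : ∀ r ∈ R, u ⬝ₑ r = 0)
    (hRm : ∀ r ∈ R, m ⬝ₑ r = 0) : Stabilizes R (eichler u m n) :=
  ⟨eichler_preservesForm hu hm hn, fun r hr => by
    rw [eichler_apply, form_comm r u, form_comm r m, hRu r hr, hRm r hr]; simp⟩

theorem stabilizes_rootReflection {R : Submodule ℤ E10} {r : E10} (hr : r ⬝ₑ r = -2)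
    (hR : ∀ s ∈ R, r ⬝ₑ s = 0) : Stabilizes R (rootReflection r) :=
  ⟨rootReflection_preservesForm hr, fun s hs => by
    rw [rootReflection_apply, form_comm, hR s hs, zero_smul, add_zero]⟩

theorem rootReflection_dualNullRoot : rootReflection (simpleRoot 0) dualNullRoot = nullRoot := by
  rw [rootReflection_apply, show dualNullRoot ⬝ₑ simpleRoot 0 = -1 by decide +kernel]
  module

theorem exists_move_to_dualNullRoot {R : Submodule ℤ E10} (hu : ∀ r ∈ R, nullRoot ⬝ₑ r = 0)
    (hv : ∀ r ∈ R, dualNullRoot ⬝ₑ r = 0) {x : E10} (hx : ∀ r ∈ R, x ⬝ₑ r = 0) (hxx : 4 ∣ x ⬝ₑ x)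
    (hodd : ¬ 2 ∣ x ⬝ₑ nullRoot) :
    ∃ g, Stabilizes R g ∧ g nullRoot = nullRoot ∧ red (g x) = red dualNullRoot := by
  obtain ⟨z, hz⟩ : ∃ z, z = x - (x ⬝ₑ dualNullRoot) • nullRoot - (x ⬝ₑ nullRoot) • dualNullRoot :=
    ⟨_, rfl⟩
  have hx' : x = (x ⬝ₑ dualNullRoot) • nullRoot + (x ⬝ₑ nullRoot) • dualNullRoot + z := by
    rw [hz]; abel
  have hzu : z ⬝ₑ nullRoot = 0 := by
    rw [hz, form_sub_left, form_sub_left, form_smul_left, form_smul_left, nullRoot_form_self,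
      dualNullRoot_form_nullRoot]; ring
  have hzR : ∀ r ∈ R, z ⬝ₑ r = 0 := fun r hr => by
    rw [hz, form_sub_left, form_sub_left, form_smul_left, form_smul_left, hu r hr, hv r hr, hx r hr]
    ring
  generalize x ⬝ₑ dualNullRoot = a at hx'
  obtain ⟨k, hk⟩ : ∃ k, x ⬝ₑ nullRoot = 2 * k + 1 := ⟨x ⬝ₑ nullRoot / 2, by omega⟩
  let m := (-(2 * k + 1)) • z
  have hmu : m ⬝ₑ nullRoot = 0 := by rw [form_smul_left, hzu, mul_zero]
  obtain ⟨n, hn⟩ := two_dvd_form_self m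
  have hst : Stabilizes R (eichler nullRoot m n) :=
    stabilizes_eichler nullRoot_form_self hmu hn hu fun r hr => by
      rw [form_smul_left, hzR r hr, mul_zero]
  have hy : eichler nullRoot m n x = ((a - x ⬝ₑ m - n * (2 * k + 1)) • nullRoot + dualNullRoot) +
      (2 : ℤ) • (k • dualNullRoot - (2 * (k ^ 2 + k)) • z) := by
    rw [eichler_apply, hk]
    conv_lhs => lhs; lhs; lhs; rw [hx', hk]
    simp only [m]
    module
  generalize a - x ⬝ₑ m - n * (2 * k + 1) = A at hy
  have h4 := q2_eq_q2_iff.1 (congrArg q2 (red_eq_red_iff.2 ⟨_, hy⟩))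
  rw [hst.1] at h4
  rw [form_smul_add_self nullRoot_form_self dualNullRoot_form_self,
    nullRoot_form_dualNullRoot] at h4
  obtain ⟨B, rfl⟩ : 2 ∣ A := by omega
  refine ⟨_, hst, ?_, red_eq_red_iff.2
    ⟨B • nullRoot + (k • dualNullRoot - (2 * (k ^ 2 + k)) • z), ?_⟩⟩
  · rw [eichler_apply, nullRoot_form_self, form_comm, hmu]; simp
  · rw [hy]; module

theorem exists_move_to_nullRoot {R : Submodule ℤ E10} (hu : ∀ r ∈ R, nullRoot ⬝ₑ r = 0)
    (hv : ∀ r ∈ R, dualNullRoot ⬝ₑ r = 0) {x y : E10} (hx : ∀ r ∈ R, x ⬝ₑ r = 0)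
    (hxx : 4 ∣ x ⬝ₑ x) (hy : ∀ r ∈ R, y ⬝ₑ r = 0) (hodd : ¬ 2 ∣ x ⬝ₑ y) :
    ∃ g, Stabilizes R g ∧ red (g x) = red nullRoot := by
  have hs : Stabilizes R (rootReflection (simpleRoot 0)) :=
    stabilizes_rootReflection (simpleRoot_form_self 0) fun r hr => by
      have := hv r hr
      rwa [form_add_left, hu r hr, add_zero] at this
  have h1 : ∀ x, (∀ r ∈ R, x ⬝ₑ r = 0) → 4 ∣ x ⬝ₑ x → ¬ 2 ∣ x ⬝ₑ nullRoot →
      ∃ g, Stabilizes R g ∧ red (g x) = red nullRoot := fun x hx hxx hodd => by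
    obtain ⟨g, hg, -, hgx⟩ := exists_move_to_dualNullRoot hu hv hx hxx hodd
    obtain ⟨z, hz⟩ := red_eq_red_iff.1 hgx
    refine ⟨_, hs.comp hg, ?_⟩
    rw [LinearMap.comp_apply, hz, map_add, rootReflection_dualNullRoot, map_smul,
      red_eq_red_iff]
    exact ⟨_, rfl⟩
  have h2 : ∀ x, (∀ r ∈ R, x ⬝ₑ r = 0) → 4 ∣ x ⬝ₑ x → ¬ 2 ∣ x ⬝ₑ dualNullRoot →
      ∃ g, Stabilizes R g ∧ red (g x) = red nullRoot := fun x hx hxx hodd => by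
    obtain ⟨g, hg, hgx⟩ := h1 (rootReflection (simpleRoot 0) x) (hs.orthogonal hx)
      (by rwa [hs.1]) (by rwa [← rootReflection_dualNullRoot, hs.1])
    exact ⟨_, hg.comp hs, hgx⟩
  by_cases hxu : 2 ∣ x ⬝ₑ nullRoot
  swap
  · exact h1 x hx hxx hxu
  by_cases hxv : 2 ∣ x ⬝ₑ dualNullRoot
  swap
  · exact h2 x hx hxx hxv
  obtain ⟨m, hm⟩ : ∃ m, m = y - (y ⬝ₑ dualNullRoot) • nullRoot - (y ⬝ₑ nullRoot) • dualNullRoot :=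
    ⟨_, rfl⟩
  have hmu : m ⬝ₑ nullRoot = 0 := by
    rw [hm, form_sub_left, form_sub_left, form_smul_left, form_smul_left, nullRoot_form_self,
      dualNullRoot_form_nullRoot]; ring
  have hmv : m ⬝ₑ dualNullRoot = 0 := by
    rw [hm, form_sub_left, form_sub_left, form_smul_left, form_smul_left, dualNullRoot_form_self,
      nullRoot_form_dualNullRoot]; ring
  have hmR : ∀ r ∈ R, m ⬝ₑ r = 0 := fun r hr => by
    rw [hm, form_sub_left, form_sub_left, form_smul_left, form_smul_left, hu r hr, hv r hr, hy r hr]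
    ring
  have hxm : ¬ 2 ∣ x ⬝ₑ m := by
    rw [hm, form_sub_right, form_sub_right, form_smul_right, form_smul_right]
    rwa [dvd_sub_left (hxv.mul_left _), dvd_sub_left (hxu.mul_left _)]
  obtain ⟨n, hn⟩ := two_dvd_form_self m
  have hst : Stabilizes R (eichler nullRoot m n) :=
    stabilizes_eichler nullRoot_form_self hmu hn hu hmR
  obtain ⟨g, hg, hgx⟩ := h2 _ (hst.orthogonal hx) (by rwa [hst.1]) (by
    rw [eichler_apply, form_sub_left, form_sub_left, form_add_left, form_smul_left, form_smul_left,
      form_smul_left, hmv, nullRoot_form_dualNullRoot, mul_one, mul_one, mul_zero, add_zero]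
    rwa [dvd_sub_left (hxu.mul_left _), dvd_sub_right hxv])
  exact ⟨_, hg.comp hst, hgx⟩

/-- The isometry acting as the identity on the hyperbolic plane and as `-1` on its orthogonal. -/
def planeInvolution : E10 →ₗ[ℤ] E10 :=
  (2 : ℤ) • (formRight dualNullRoot).smulRight nullRoot +
    (2 : ℤ) • (formRight nullRoot).smulRight dualNullRoot - LinearMap.id

theorem planeInvolution_apply (x : E10) : planeInvolution x =
    (2 : ℤ) • (x ⬝ₑ dualNullRoot) • nullRoot + (2 : ℤ) • (x ⬝ₑ nullRoot) • dualNullRoot - x := rfl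

theorem planeInvolution_preservesForm : PreservesForm planeInvolution := fun x y => by
  have key : ∀ u v : E10, u ⬝ₑ u = 0 → v ⬝ₑ v = 0 → u ⬝ₑ v = 1 →
      ((2 : ℤ) • (x ⬝ₑ v) • u + (2 : ℤ) • (x ⬝ₑ u) • v - x) ⬝ₑ
        ((2 : ℤ) • (y ⬝ₑ v) • u + (2 : ℤ) • (y ⬝ₑ u) • v - y) = x ⬝ₑ y := fun u v hu hv huv => by
    simp only [form_add_left, form_add_right, form_sub_left, form_sub_right, form_smul_left,
      form_smul_right, hu, hv, huv, form_comm v, form_comm u y]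
    ring
  exact key _ _ nullRoot_form_self dualNullRoot_form_self nullRoot_form_dualNullRoot

theorem red_planeInvolution (x : E10) : red (planeInvolution x) = red x := by
  rw [planeInvolution_apply, red_eq_red_iff]
  exact ⟨(x ⬝ₑ dualNullRoot) • nullRoot + (x ⬝ₑ nullRoot) • dualNullRoot - x, by module⟩

theorem exists_stabilizing_lift_of_fixes_plane {R : Submodule ℤ E10}
    (hR : IsIrreducibleRootLattice R)
    (h01 : ∀ r ∈ R, r 0 = 0 ∧ r 1 = 0) {h : V10 →ₗ[ZMod 2] V10} (hq : PreservesQ h)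
    (h0 : h (red (simpleRoot 0)) = red (simpleRoot 0)) (hn : h (red nullRoot) = red nullRoot)
    (hfix : ∀ r ∈ R, h (red r) = red r) :
    ∃ g, Stabilizes R g ∧ ∀ x, red (g x) = h (red x) := by
  obtain ⟨g, hg, hg0, hgn, hred⟩ := exists_lift_of_fixes_plane hq h0 hn
  have hg1 : ∀ r ∈ R, g r 1 = 0 := fun r hr => by
    have h1 := hg r nullRoot
    have h2 := hg r (simpleRoot 0)
    rw [hgn, form_weight, form_weight, (h01 r hr).1] at h1
    rw [hg0, form_simpleRoot_zero, form_simpleRoot_zero, (h01 r hr).1, (h01 r hr).2, h1] at h2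
    simpa using h2
  have hsign : ∀ r ∈ R, r ⬝ₑ r = -2 → g r = r ∨ g r = -r := fun r hr hrr =>
    eq_or_eq_neg_of_red_eq (hg1 r hr) (h01 r hr).2 (by rw [hg, hrr]) hrr (by rw [hred, hfix r hr])
  rcases hR.irreducible (fun r => g r = r) (fun s hs hss t ht htt h1 h2 => by
    have := hg s t
    rw [h1, (hsign t ht htt).resolve_left h2, form_neg_right] at this
    omega) with h | h
  · exact ⟨g, ⟨hg, hR.induction (S := LinearMap.eqLocus g LinearMap.id) h⟩, hred⟩
  · refine ⟨planeInvolution ∘ₗ g, ⟨planeInvolution_preservesForm.comp hg,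
      hR.induction (S := LinearMap.eqLocus (planeInvolution ∘ₗ g) LinearMap.id)
        fun r hr hrr => ?_⟩, fun x => by rw [LinearMap.comp_apply, red_planeInvolution, hred]⟩
    rw [LinearMap.mem_eqLocus, LinearMap.comp_apply, (hsign r hr hrr).resolve_left (h r hr hrr),
      planeInvolution_apply, form_neg_left, form_neg_left, form_nullRoot_add, form_weight,
      (h01 r hr).1, (h01 r hr).2]
    simp

theorem isLiftable_of_orthogonal_plane {R : Submodule ℤ E10} (hR : IsIrreducibleRootLattice R)
    (h01 : ∀ r ∈ R, r 0 = 0 ∧ r 1 = 0) : IsLiftable R := by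
  intro h hq hfix hperp
  have hu : ∀ r ∈ R, nullRoot ⬝ₑ r = 0 := fun r hr => by rw [form_comm, form_weight, (h01 r hr).1]
  have hv : ∀ r ∈ R, dualNullRoot ⬝ₑ r = 0 := fun r hr => by
    rw [form_comm, form_nullRoot_add, (h01 r hr).1, (h01 r hr).2, sub_self]
  obtain ⟨x, hxR, hx⟩ := hperp nullRoot hu
  obtain ⟨y, hyR, hy⟩ := hperp dualNullRoot hv
  have hxx := form_self_lift hq hx
  have hyy := form_self_lift hq hy
  have hxy := form_lift_parity hq hx hy
  rw [nullRoot_form_self, sub_zero] at hxx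
  rw [dualNullRoot_form_self, sub_zero] at hyy
  rw [nullRoot_form_dualNullRoot] at hxy
  obtain ⟨g₁, hg₁, hg₁x⟩ := exists_move_to_nullRoot hu hv hxR hxx hyR (by omega)
  obtain ⟨z, hz⟩ := red_eq_red_iff.1 hg₁x
  obtain ⟨g₂, hg₂, hg₂u, hg₂y⟩ := exists_move_to_dualNullRoot hu hv (hg₁.orthogonal hyR)
    (by rwa [hg₁.1]) (by
      have := hg₁.1 x y
      rw [hz, form_add_left, form_smul_left, form_comm] at this
      omega)
  obtain ⟨e, he⟩ := (hg₂.comp hg₁).1.exists_equiv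
  have hest := hg₂.comp hg₁
  rw [← he] at hest
  obtain ⟨k, hk, hek⟩ := hest.1.exists_reduction
  have hex : k (h (red nullRoot)) = red nullRoot := by
    rw [← hx, ← hek, ← LinearEquiv.coe_coe, he, LinearMap.comp_apply, hz, map_add, map_smul, hg₂u,
      red_eq_red_iff]
    exact ⟨_, rfl⟩
  have hey : k (h (red dualNullRoot)) = red dualNullRoot := by
    rw [← hy, ← hek, ← LinearEquiv.coe_coe, he, LinearMap.comp_apply, hg₂y]
  obtain ⟨g, hg, hgred⟩ := exists_stabilizing_lift_of_fixes_plane hR h01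
    (h := (k : V10 →ₗ[ZMod 2] V10) ∘ₗ h) (fun v => by
      rw [LinearMap.comp_apply, hk, hq])
    (by
      rw [red_add] at hey
      simp only [map_add, hex] at hey
      exact add_right_cancel hey)
    hex
    (fun r hr => by
      rw [LinearMap.comp_apply, hfix r hr, LinearEquiv.coe_coe, ← hek]
      exact congrArg red (hest.2 r hr))
  refine ⟨e.symm ∘ₗ g, hest.1.symm.comp hg.1, fun r hr => ?_, fun x => ?_⟩
  · rw [LinearMap.comp_apply, hg.2 r hr, LinearEquiv.coe_coe, LinearEquiv.symm_apply_eq]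
    exact (hest.2 r hr).symm
  · apply k.injective
    rw [← hek, LinearMap.comp_apply, LinearEquiv.coe_coe, LinearEquiv.apply_symm_apply, hgred]
    rfl

/-! ### Moving subdiagrams -/

theorem exists_isometry_of_gram {w : Fin 10 → E10}
    (hw : (List.finRange 10).all (fun i =>
      (List.finRange 10).all fun j => w i ⬝ₑ w j == e10Gram i j) = true) :
    ∃ g : E10 →ₗ[ℤ] E10, PreservesForm g ∧ ∀ i, g (simpleRoot i) = w i :=
  exists_preservesForm w fun i j => by
    simp only [List.all_eq_true, beq_iff_eq] at hw
    exact hw i (List.mem_finRange i) j (List.mem_finRange j)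

theorem exists_isometry_chain_zero_six : ∃ g : E10 →ₗ[ℤ] E10, PreservesForm g ∧
    ∀ i ∈ [0, 1, 2, 3, 4, 5, 6], g (simpleRoot i) = simpleRoot (i + 2) := by
  obtain ⟨g, hg, h⟩ := exists_isometry_of_gram (w := ![simpleRoot 2, simpleRoot 3, simpleRoot 4,
    simpleRoot 5, simpleRoot 6, simpleRoot 7, simpleRoot 8,
    ![-1, -1, -1, -1, -1, -1, -1, -1, -1, 0],
    simpleRoot 0, ![1, 2, 2, 2, 2, 2, 2, 1, 0, 1]]) (by decide +kernel)
  exact ⟨g, hg, by simp [h]⟩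

theorem exists_isometry_chain_one_seven : ∃ g : E10 →ₗ[ℤ] E10, PreservesForm g ∧
    ∀ i ∈ [1, 2, 3, 4, 5, 6, 7], g (simpleRoot i) = simpleRoot (i + 1) := by
  obtain ⟨g, hg, h⟩ := exists_isometry_of_gram (w := ![simpleRoot 0 + simpleRoot 1, simpleRoot 2,
    simpleRoot 3, simpleRoot 4, simpleRoot 5, simpleRoot 6, simpleRoot 7, simpleRoot 8,
    ![0, -1, -1, -1, -1, -1, -1, -1, -1, 0], ![0, 1, 1, 1, 1, 1, 1, 0, 0, 1]]) (by decide +kernel)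
  exact ⟨g, hg, by simp [h]⟩

theorem exists_isometry_chain_one_six_nine : ∃ g : E10 →ₗ[ℤ] E10, PreservesForm g ∧
    ∀ i ∈ [1, 2, 3, 4, 5, 6, 9], g (simpleRoot i) = simpleRoot (if i = 9 then 8 else i + 1) := by
  obtain ⟨g, hg, h⟩ := exists_isometry_of_gram (w := ![![-1, -2, -3, -3, -3, -3, -3, -2, -1, -1],
    simpleRoot 2, simpleRoot 3, simpleRoot 4, simpleRoot 5, simpleRoot 6, simpleRoot 7,
    ![0, 1, 1, 1, 1, 1, 1, 0, 0, 1], simpleRoot 0, simpleRoot 8]) (by decide +kernel)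
  exact ⟨g, hg, by simp [h]⟩

theorem exists_isometry_chain_one_eight : ∃ g : E10 →ₗ[ℤ] E10, PreservesForm g ∧
    ∀ i ∈ [1, 2, 3, 4, 5, 6, 7, 8], g (simpleRoot i) = simpleRoot (i - 1) := by
  obtain ⟨g, hg, h⟩ := exists_isometry_of_gram (w := ![![-1, -1, -1, -1, -1, -1, -1, -1, -1, 0],
    simpleRoot 0, simpleRoot 1, simpleRoot 2, simpleRoot 3, simpleRoot 4, simpleRoot 5,
    simpleRoot 6, simpleRoot 7, ![0, 0, 0, 0, 0, 0, 1, 1, 1, 1]]) (by decide +kernel)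
  exact ⟨g, hg, by simp [h]⟩

theorem exists_isometry_chain_zero_six_nine : ∃ g : E10 →ₗ[ℤ] E10, PreservesForm g ∧
    ∀ i ∈ [0, 1, 2, 3, 4, 5, 6, 9], g (simpleRoot i) = simpleRoot (if i = 9 then 7 else i) := by
  obtain ⟨g, hg, h⟩ := exists_isometry_of_gram (w := ![simpleRoot 0, simpleRoot 1, simpleRoot 2,
    simpleRoot 3, simpleRoot 4, simpleRoot 5, simpleRoot 6, simpleRoot 9,
    ![-1, -2, -3, -4, -5, -6, -7, -4, -1, -4], simpleRoot 7]) (by decide +kernel)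
  exact ⟨g, hg, by simp [h]⟩

theorem IsSupportedOn.eq_sum {R : Submodule ℤ E10} {J : Set (Fin 10)} (hR : IsSupportedOn R J)
    {g : E10 →ₗ[ℤ] E10} {σ : Fin 10 → Fin 10} (hσ : ∀ i ∈ J, g (simpleRoot i) = simpleRoot (σ i))
    {r : E10} (hr : r ∈ R) : g r = ∑ i, r i • simpleRoot (σ i) := by
  conv_lhs => rw [eq_sum_simpleRoot r]
  rw [map_sum]
  refine Finset.sum_congr rfl fun i _ => ?_
  rw [map_smul]
  by_cases hi : i ∈ J
  · rw [hσ i hi]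
  · rw [hR.apply_eq_zero r hr i hi, zero_smul, zero_smul]

theorem IsSupportedOn.map {R : Submodule ℤ E10} {J K : Set (Fin 10)} (hR : IsSupportedOn R J)
    {g : E10 →ₗ[ℤ] E10} (hg : PreservesForm g) {σ : Fin 10 → Fin 10}
    (hσ : ∀ i ∈ J, g (simpleRoot i) = simpleRoot (σ i)) (hK : σ '' J = K) :
    IsSupportedOn (R.map g) K where
  apply_eq_zero := by
    rintro _ ⟨r, hr, rfl⟩ k hk
    rw [hR.eq_sum hσ hr, Finset.sum_apply]
    refine Finset.sum_eq_zero fun i _ => ?_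
    by_cases hi : i ∈ J
    · have : σ i ≠ k := fun h => hk (hK ▸ ⟨i, hi, h⟩)
      simp [simpleRoot, this.symm]
    · simp [hR.apply_eq_zero r hr i hi]
  full := by
    rw [← hK]
    rintro y hy _ ⟨i, hi, rfl⟩
    obtain ⟨e, rfl⟩ := hg.exists_equiv
    have h1 : ∀ x, y ⬝ₑ e x = e.symm y ⬝ₑ x := fun x => by
      have := hg (e.symm y) x
      rwa [LinearEquiv.coe_coe, LinearEquiv.apply_symm_apply] at this
    rw [← hσ i hi, LinearEquiv.coe_coe, h1]
    exact hR.full _ (fun r hr => by rw [← h1]; exact hy _ ⟨r, hr, rfl⟩) i hi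

theorem IsSupportedOn.exists_orthogonal_plane {R : Submodule ℤ E10} {J : Set (Fin 10)}
    (hR : IsSupportedOn R J) {K : List (Fin 10)} (hK : K ∈ splitSubdiagrams) (hJ : ∀ i ∈ J, i ∈ K) :
    ∃ g : E10 →ₗ[ℤ] E10, PreservesForm g ∧ ∀ r ∈ R.map g, r 0 = 0 ∧ r 1 = 0 := by
  have key : ∀ σ : Fin 10 → Fin 10, (∀ i ∈ K, σ i ≠ 0 ∧ σ i ≠ 1) →
      (∃ g : E10 →ₗ[ℤ] E10, PreservesForm g ∧ ∀ i ∈ K, g (simpleRoot i) = simpleRoot (σ i)) →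
      ∃ g : E10 →ₗ[ℤ] E10, PreservesForm g ∧ ∀ r ∈ R.map g, r 0 = 0 ∧ r 1 = 0 := by
    rintro σ hσ ⟨g, hg, hgσ⟩
    have := hR.map hg (fun i hi => hgσ i (hJ i hi)) rfl
    refine ⟨g, hg, fun r hr => ⟨this.apply_eq_zero r hr 0 ?_, this.apply_eq_zero r hr 1 ?_⟩⟩
    · rintro ⟨i, hi, h⟩
      exact (hσ i (hJ i hi)).1 h
    · rintro ⟨i, hi, h⟩
      exact (hσ i (hJ i hi)).2 h
  simp only [splitSubdiagrams, List.mem_cons, List.not_mem_nil, or_false] at hK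
  rcases hK with rfl | rfl | rfl | rfl
  · exact key id (by decide) ⟨LinearMap.id, preservesForm_id, fun i _ => rfl⟩
  · exact key _ (by decide) exists_isometry_chain_zero_six
  · exact key _ (by decide) exists_isometry_chain_one_seven
  · exact key _ (by decide) exists_isometry_chain_one_six_nine

/-! ### Root sublattices of full rank in `A_n` -/

theorem exists_two_units {ι : Type*} [Fintype ι] [DecidableEq ι] {z : ι → ℤ}
    (hz : ∑ i, z i ^ 2 = 2) :
    ∃ a b, a ≠ b ∧ (z a = 1 ∨ z a = -1) ∧ (z b = 1 ∨ z b = -1) ∧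
      ∀ c, c ≠ a → c ≠ b → z c = 0 := by
  have hle : ∀ s : Finset ι, ∑ i ∈ s, z i ^ 2 ≤ 2 := fun s => hz ▸
    Finset.sum_le_sum_of_subset_of_nonneg (Finset.subset_univ s) fun i _ _ => sq_nonneg (z i)
  have hunit : ∀ i, z i ≠ 0 → z i = 1 ∨ z i = -1 := fun i hi => by
    have := hle {i}
    rw [Finset.sum_singleton] at this
    have h1 : z i < 2 := by nlinarith
    have h2 : -2 < z i := by nlinarith
    omega
  obtain ⟨a, ha⟩ : ∃ a, z a ≠ 0 := by
    by_contra! h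
    simp [h] at hz
  have hsq : ∀ i, z i ≠ 0 → z i ^ 2 = 1 := fun i hi => by rcases hunit i hi with h | h <;> simp [h]
  obtain ⟨b, hba, hb⟩ : ∃ b, b ≠ a ∧ z b ≠ 0 := by
    by_contra! h
    rw [Finset.sum_eq_single a (fun i _ hi => by simp [h i hi]) (by simp), hsq a ha] at hz
    omega
  refine ⟨a, b, hba.symm, hunit a ha, hunit b hb, fun c hca hcb => ?_⟩
  by_contra hc
  have := hle {a, b, c}
  rw [Finset.sum_insert (by simp [hba.symm, hca.symm]), Finset.sum_insert (by simp [hcb.symm]),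
    Finset.sum_singleton, hsq a ha, hsq b hb, hsq c hc] at this
  omega

/-- The sum of the first `k` simple roots. -/
def chainSum (k : ℕ) : E10 := fun i => if i.val < k then 1 else 0

theorem chainSum_succ (i : Fin 10) : chainSum (i + 1) = chainSum i + simpleRoot i := by
  ext j
  rcases lt_trichotomy j i with h | rfl | h
  · have : j.val < i.val := h
    simp [chainSum, simpleRoot, h.ne, this, this.trans]
  · simp [chainSum, simpleRoot]
  · have : i.val < j.val := h
    simp [chainSum, simpleRoot, h.ne', this.not_gt, h]

theorem exists_chainSum_sub {r : E10} (hr : r ⬝ₑ r = -2) (h9 : r 9 = 0) :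
    ∃ a b : ℕ, a ≤ 9 ∧ b ≤ 9 ∧ r = chainSum b - chainSum a := by
  let z : Fin 10 → ℤ := ![r 0, r 1 - r 0, r 2 - r 1, r 3 - r 2, r 4 - r 3, r 5 - r 4, r 6 - r 5,
    r 7 - r 6, r 8 - r 7, -r 8]
  have hz : ∑ i, z i ^ 2 = 2 := by
    rw [form_explicit, h9] at hr
    simp only [z, Fin.sum_univ_succ, Matrix.cons_val_zero, Matrix.cons_val_succ, Fin.sum_univ_zero]
    linarith
  have hpart : ∀ i, r i = ∑ k, if k ≤ i then z k else 0 := by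
    intro i
    fin_cases i <;> simp [z, Fin.sum_univ_succ, h9, Fin.le_def]
    ring
  have hsum : ∑ k, z k = 0 := by
    rw [← h9, hpart 9]
    exact Finset.sum_congr rfl fun k _ => (if_pos (Fin.le_last k)).symm
  have key : ∀ a b : Fin 10, a ≠ b → z a = 1 → z b = -1 → (∀ c, c ≠ a → c ≠ b → z c = 0) →
      ∃ a b : ℕ, a ≤ 9 ∧ b ≤ 9 ∧ r = chainSum b - chainSum a := by
    intro a b hab ha hb h0
    refine ⟨a, b, by omega, by omega, ?_⟩
    have hzs : z = Pi.single a 1 - Pi.single b 1 := by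
      ext c
      by_cases hca : c = a
      · subst hca; simp [ha, hab]
      · by_cases hcb : c = b
        · subst hcb; simp [hb, hca]
        · simp [h0 c hca hcb, hca, hcb]
    ext i
    rw [hpart, hzs]
    have : ∀ c : Fin 10, (∑ k, if k ≤ i then (Pi.single c 1 : Fin 10 → ℤ) k else 0) =
        1 - chainSum c i := by
      intro c
      rw [Finset.sum_eq_single c (fun k _ hk => by simp [hk]) (by simp)]
      simp only [Pi.single_eq_same, chainSum, Fin.le_def]
      split_ifs <;> omega
    simp only [Pi.sub_apply]
    rw [← sub_sub_sub_cancel_left _ _ (1 : ℤ), ← this a, ← this b, ← Finset.sum_sub_distrib]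
    exact Finset.sum_congr rfl fun k _ => by split_ifs <;> simp
  obtain ⟨a, b, hab, ha, hb, h0⟩ := exists_two_units hz
  have hsum2 : z a + z b = 0 := by
    rw [← hsum, ← Finset.sum_pair hab]
    exact Finset.sum_subset (Finset.subset_univ _) fun c _ hc => by
      simp only [Finset.mem_insert, Finset.mem_singleton, not_or] at hc
      exact h0 c hc.1 hc.2
  rcases ha with ha | ha
  · exact key a b hab ha (by omega) h0
  · exact key b a hab.symm (by omega) ha fun c h1 h2 => h0 c h2 h1

theorem IsSupportedOn.simpleRoot_mem_of_chain {R : Submodule ℤ E10} {J : Set (Fin 10)}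
    (hJ : IsSupportedOn R J) (hR : IsIrreducibleRootLattice R) {n : ℕ} (hn : n ≤ 9)
    (hJn : ∀ i, i ∈ J ↔ i.val < n) : ∀ j ∈ J, simpleRoot j ∈ R := by
  classical
  let f : ℕ → ℤ := fun k => if chainSum k ∈ R then 1 else 0
  let y : E10 := ∑ j : Fin 10, (f (j + 1) - f j) • weight j
  have hyx : ∀ x, y ⬝ₑ x = ∑ j : Fin 10, (f (j + 1) - f j) * x j := fun x => by
    rw [form_comm]
    simp only [y, form_sum_right, form_smul_right, form_weight]
  have hy : ∀ k ≤ 9, y ⬝ₑ chainSum k = f k - f 0 := by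
    intro k hk
    rw [hyx]
    interval_cases k <;> simp [Fin.sum_univ_succ, chainSum]
  have hyR : ∀ r ∈ R, y ⬝ₑ r = 0 := by
    have : R ≤ LinearMap.ker (formRight y) := by
      refine hR.induction fun r hr hrr => ?_
      obtain ⟨a, b, ha, hb, rfl⟩ := exists_chainSum_sub hrr
        (hJ.apply_eq_zero r hr 9 fun h => by simp [hJn] at h; omega)
      rw [LinearMap.mem_ker, formRight_apply, form_comm, form_sub_right, hy a ha, hy b hb]
      have : chainSum a ∈ R ↔ chainSum b ∈ R :=
        ⟨fun h => by simpa using R.add_mem hr h, fun h => by simpa using R.sub_mem h hr⟩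
      simp [f, this]
    intro r hr
    rw [form_comm]
    exact this hr
  have hstep : ∀ j ∈ J, f (j.val + 1) = f j.val := fun j hj => by
    have := hJ.full y hyR j hj
    rw [hyx, Finset.sum_eq_single j (fun k _ hk => by simp [simpleRoot, hk]) (by simp)] at this
    simp only [simpleRoot, Pi.single_eq_same, mul_one] at this
    omega
  have hmem : ∀ k ≤ n, chainSum k ∈ R := by
    intro k
    induction k with
    | zero => exact fun _ => by convert R.zero_mem; ext; simp [chainSum]
    | succ k ih =>
      intro hk
      have h := hstep ⟨k, by omega⟩ ((hJn _).2 (by simpa using hk))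
      simp only [f, ih (by omega), if_true] at h
      by_contra hc
      simp [hc] at h
  intro j hj
  have h1 := hmem (j + 1) ((hJn j).1 hj)
  have h2 := hmem j ((hJn j).1 hj).le
  rw [chainSum_succ] at h1
  simpa using R.sub_mem h1 h2

/-! ### Root sublattices of full rank in `D₈` and `D₉` -/

/-- Twice the orthogonal frame in which the simple roots other than `e₈` generate `D₉`. -/
def frame : Fin 9 → E10 :=
  ![![2, 2, 2, 2, 2, 2, 2, 1, 0, 1], ![0, 2, 2, 2, 2, 2, 2, 1, 0, 1],
    ![0, 0, 2, 2, 2, 2, 2, 1, 0, 1], ![0, 0, 0, 2, 2, 2, 2, 1, 0, 1],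
    ![0, 0, 0, 0, 2, 2, 2, 1, 0, 1], ![0, 0, 0, 0, 0, 2, 2, 1, 0, 1],
    ![0, 0, 0, 0, 0, 0, 2, 1, 0, 1], ![0, 0, 0, 0, 0, 0, 0, 1, 0, 1],
    ![0, 0, 0, 0, 0, 0, 0, -1, 0, 1]]

theorem form_frame (a b : Fin 9) : frame a ⬝ₑ frame b = if a = b then -4 else 0 := by
  have : (List.finRange 9).all (fun a => (List.finRange 9).all fun b =>
      frame a ⬝ₑ frame b == if a = b then -4 else 0) = true := by decide +kernel
  simp only [List.all_eq_true, beq_iff_eq] at this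
  exact this a (List.mem_finRange a) b (List.mem_finRange b)

theorem exists_frame {r : E10} (hr : r ⬝ₑ r = -2) (h8 : r 8 = 0) :
    ∃ (a b : Fin 9) (s t : ℤ), a ≠ b ∧ (s = 1 ∨ s = -1) ∧ (t = 1 ∨ t = -1) ∧
      (2 : ℤ) • r = s • frame a + t • frame b ∧ (r 0 = 0 → a ≠ 0 ∧ b ≠ 0) := by
  let z : Fin 9 → ℤ := ![r 0, r 1 - r 0, r 2 - r 1, r 3 - r 2, r 4 - r 3, r 5 - r 4, r 6 - r 5,
    r 7 - r 6 + r 9, r 9 - r 7]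
  have hz : ∑ i, z i ^ 2 = 2 := by
    rw [form_explicit, h8] at hr
    simp only [z, Fin.sum_univ_succ, Matrix.cons_val_zero, Matrix.cons_val_succ, Fin.sum_univ_zero]
    linarith
  have hsum : (2 : ℤ) • r = ∑ a, z a • frame a := by
    ext i
    fin_cases i <;> simp [z, Fin.sum_univ_succ, frame, h8] <;> ring
  obtain ⟨a, b, hab, ha, hb, h0⟩ := exists_two_units hz
  refine ⟨a, b, z a, z b, hab, ha, hb, ?_, fun hr0 => ⟨?_, ?_⟩⟩
  · rw [hsum, ← Finset.sum_pair (f := fun a => z a • frame a) hab]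
    refine (Finset.sum_subset (Finset.subset_univ _) fun c _ hc => ?_).symm
    simp only [Finset.mem_insert, Finset.mem_singleton, not_or] at hc
    rw [h0 c hc.1 hc.2, zero_smul]
  · rintro rfl
    simp [z, hr0] at ha
  · rintro rfl
    simp [z, hr0] at hb

theorem two_smul_injective {x y : E10} (h : (2 : ℤ) • x = (2 : ℤ) • y) : x = y :=
  smul_right_injective E10 (two_ne_zero (α := ℤ)) h

/-- The vector `(frame a - σ • frame b) / 2` exists and lies in `R`. -/
def FrameRel (R : Submodule ℤ E10) (a b : Fin 9) (σ : ℤ) : Prop :=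
  ∃ x ∈ R, (2 : ℤ) • x = frame a - σ • frame b

theorem FrameRel.step {R : Submodule ℤ E10} {a b c : Fin 9} {s t σ : ℤ} {r : E10} (hr : r ∈ R)
    (hrst : (2 : ℤ) • r = s • frame b + t • frame c) (hs : s = 1 ∨ s = -1)
    (h : FrameRel R a b σ) : FrameRel R a c (-(s * t * σ)) := by
  obtain ⟨x, hx, h2⟩ := h
  refine ⟨x + (σ * s) • r, R.add_mem hx (R.smul_mem _ hr), ?_⟩
  rw [smul_add, smul_comm, hrst, h2]
  rcases hs with rfl | rfl <;> module

theorem IsSupportedOn.form_eq_zero {R : Submodule ℤ E10} {J : Set (Fin 10)}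
    (hJ : IsSupportedOn R J) {y x : E10} (hy : ∀ r ∈ R, y ⬝ₑ r = 0) (hx : ∀ i ∉ J, x i = 0) :
    y ⬝ₑ x = 0 := by
  rw [form_comm, form_eq_sum]
  refine Finset.sum_eq_zero fun i _ => ?_
  by_cases hi : i ∈ J
  · rw [hJ.full y hy i hi, mul_zero]
  · rw [hx i hi, zero_mul]

theorem IsIrreducibleRootLattice.form_eq_zero {R : Submodule ℤ E10}
    (hR : IsIrreducibleRootLattice R) {y : E10} (h : ∀ r ∈ R, r ⬝ₑ r = -2 → y ⬝ₑ r = 0) :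
    ∀ r ∈ R, y ⬝ₑ r = 0 := by
  have : R ≤ LinearMap.ker (formRight y) := hR.induction fun r hr hrr => by
    rw [LinearMap.mem_ker, formRight_apply, form_comm, h r hr hrr]
  intro r hr
  rw [form_comm]
  exact this hr

theorem frame_apply_eq_zero {m : ℕ} {J : Set (Fin 10)} (hm : m ≤ 1)
    (hJm : ∀ i, i ∈ J ↔ m ≤ i.val ∧ i ≠ 8) {a : Fin 9} (ha : m ≤ a.val) :
    ∀ i ∉ J, frame a i = 0 := by
  intro i hi
  rw [hJm, not_and_or, not_not, not_le] at hi
  rcases hi with hi | rfl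
  · obtain rfl : i = 0 := Fin.ext (by simp; omega)
    have h0 : a ≠ 0 := by rintro rfl; simp at hi ha; omega
    clear ha
    revert a
    decide
  · clear ha
    revert a
    decide

theorem IsSupportedOn.frame_mem {R : Submodule ℤ E10} {J : Set (Fin 10)}
    (hJ : IsSupportedOn R J) (hR : IsIrreducibleRootLattice R) {m : ℕ} (hm : m ≤ 1)
    (hJm : ∀ i, i ∈ J ↔ m ≤ i.val ∧ i ≠ 8) {a₀ : Fin 9} (ha₀ : m ≤ a₀.val) : frame a₀ ∈ R := by
  classical
  let f : Fin 9 → ℤ := fun b =>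
    (if FrameRel R a₀ b 1 then 1 else 0) - if FrameRel R a₀ b (-1) then 1 else 0
  let y : E10 := ∑ b, f b • frame b
  have hy : ∀ a, y ⬝ₑ frame a = -4 * f a := fun a => by
    simp only [y, form_sum_left, form_smul_left, form_frame]
    simp [mul_comm]
  have hyR : ∀ r ∈ R, y ⬝ₑ r = 0 := hR.form_eq_zero fun r hr hrr => by
    obtain ⟨a, b, s, t, -, hs, ht, h2, -⟩ := exists_frame hrr
      (hJ.apply_eq_zero r hr 8 fun h => ((hJm 8).1 h).2 rfl)
    have h2' : (2 : ℤ) • r = t • frame b + s • frame a := by rw [h2, add_comm]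
    have hab : ∀ σ, FrameRel R a₀ a σ ↔ FrameRel R a₀ b (-(s * t * σ)) := fun σ => by
      refine ⟨FrameRel.step hr h2 hs, fun h => ?_⟩
      have := FrameRel.step hr h2' ht h
      rcases hs with rfl | rfl <;> rcases ht with rfl | rfl <;> simpa using this
    have h3 : 2 * (y ⬝ₑ r) = -4 * (s * f a + t * f b) := by
      rw [← form_smul_right, h2, form_add_right, form_smul_right, form_smul_right, hy, hy]
      ring
    have h4 : s * f a + t * f b = 0 := by
      simp only [f, hab]
      rcases hs with rfl | rfl <;> rcases ht with rfl | rfl <;> simp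
    rw [h4] at h3
    omega
  have h1 : f a₀ = 0 := by
    have := hJ.form_eq_zero hyR (frame_apply_eq_zero hm hJm ha₀)
    rw [hy] at this
    omega
  have h2 : FrameRel R a₀ a₀ 1 := ⟨0, R.zero_mem, by simp⟩
  have h3 : FrameRel R a₀ a₀ (-1) := by
    by_contra h
    simp [f, h2, h] at h1
  obtain ⟨x, hx, h⟩ := h3
  convert hx
  apply two_smul_injective
  rw [h]
  module

theorem IsSupportedOn.simpleRoot_mem_of_fork {R : Submodule ℤ E10} {J : Set (Fin 10)}
    (hJ : IsSupportedOn R J) (hR : IsIrreducibleRootLattice R) {m : ℕ} (hm : m ≤ 1)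
    (hJm : ∀ i, i ∈ J ↔ m ≤ i.val ∧ i ≠ 8) : ∀ j ∈ J, simpleRoot j ∈ R := by
  have hF : ∀ a : Fin 9, m ≤ a.val → frame a ∈ R := fun a => hJ.frame_mem hR hm hJm
  have hroot : ∀ r ∈ R, r ⬝ₑ r = -2 → ∃ a b : Fin 9, (∀ c, r ⬝ₑ frame c ≠ 0 ↔ c = a ∨ c = b) ∧
      (FrameRel R 8 a 1 ↔ FrameRel R 8 b 1) ∧
      ∃ s t : ℤ, (2 : ℤ) • r = s • frame a + t • frame b := by
    intro r hr hrr
    obtain ⟨a, b, s, t, hab, hs, ht, h2, h0⟩ := exists_frame hrr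
      (hJ.apply_eq_zero r hr 8 fun h => ((hJm 8).1 h).2 rfl)
    have hm0 : m ≤ a.val ∧ m ≤ b.val := by
      rcases Nat.eq_zero_or_pos m with rfl | hm'
      · simp
      · have := h0 (hJ.apply_eq_zero r hr 0 fun h => by
          have := ((hJm 0).1 h).1
          simp at this
          omega)
        rw [Ne, Ne, Fin.ext_iff, Fin.ext_iff] at this
        simp at this
        omega
    have hneg : ∀ c : Fin 9, m ≤ c.val → ∀ σ, FrameRel R 8 c σ → FrameRel R 8 c (-σ) := by
      rintro c hc σ ⟨x, hx, h⟩
      refine ⟨x + σ • frame c, R.add_mem hx (R.smul_mem _ (hF c hc)), ?_⟩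
      rw [smul_add, h]
      module
    have hstep : ∀ {a b : Fin 9} {s t : ℤ}, m ≤ b.val → (s = 1 ∨ s = -1) → (t = 1 ∨ t = -1) →
        (2 : ℤ) • r = s • frame a + t • frame b → FrameRel R 8 a 1 → FrameRel R 8 b 1 := by
      intro a b s t hb hs ht h2 h
      have := FrameRel.step hr h2 hs h
      have h' := hneg b hb _ this
      rcases hs with rfl | rfl <;> rcases ht with rfl | rfl <;> simp_all
    refine ⟨a, b, fun c => ?_, ⟨hstep hm0.2 hs ht h2,
      hstep hm0.1 ht hs (by rw [h2, add_comm])⟩, s, t, h2⟩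
    have h3 : 2 * (r ⬝ₑ frame c) =
        s * (if a = c then -4 else 0) + t * (if b = c then -4 else 0) := by
      rw [← form_smul_left, h2, form_add_left, form_smul_left, form_smul_left, form_frame,
        form_frame]
    by_cases hca : a = c
    · subst hca
      rw [if_pos rfl, if_neg hab.symm] at h3
      simp only [true_or, iff_true]
      omega
    · by_cases hcb : b = c
      · subst hcb
        rw [if_pos rfl, if_neg hab] at h3
        simp only [or_true, iff_true]
        omega
      · rw [if_neg hca, if_neg hcb] at h3
        simp only [Ne.symm hca, Ne.symm hcb, or_self, iff_false, not_not]
        omega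
  have hrel8 : FrameRel R 8 8 1 := ⟨0, R.zero_mem, by simp⟩
  have hne : ∀ a : Fin 9, m ≤ a.val → ¬ ∀ r ∈ R, r ⬝ₑ r = -2 → frame a ⬝ₑ r = 0 := fun a ha h => by
    have := hJ.form_eq_zero (hR.form_eq_zero h) (frame_apply_eq_zero hm hJm ha)
    rw [form_frame, if_pos rfl] at this
    omega
  have hrel : ∀ a : Fin 9, m ≤ a.val → FrameRel R 8 a 1 := by
    have hdich := hR.irreducible (fun r => ∃ a, r ⬝ₑ frame a ≠ 0 ∧ FrameRel R 8 a 1) ?_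
    · rcases hdich with h | h
      · intro a ha
        by_contra hna
        refine hne a ha fun r hr hrr => ?_
        by_contra hra
        obtain ⟨b, c, hbc, hiff, -⟩ := hroot r hr hrr
        obtain ⟨d, hd, hd'⟩ := h r hr hrr
        rw [form_comm] at hra
        rcases (hbc a).1 hra with rfl | rfl <;> rcases (hbc d).1 hd with rfl | rfl <;> tauto
      · refine absurd (fun r hr hrr => ?_) (hne 8 (by simp; omega))
        by_contra h8
        exact h r hr hrr ⟨8, by rwa [form_comm], hrel8⟩
    · rintro r hr hrr r' hr' hrr' ⟨c, hc, hc'⟩ hP'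
      obtain ⟨a, b, hab, hiff, s, t, h2⟩ := hroot r hr hrr
      have hz : ∀ d, FrameRel R 8 d 1 → r' ⬝ₑ frame d = 0 := fun d hd => by
        by_contra h
        exact hP' ⟨d, h, hd⟩
      have hab' : FrameRel R 8 a 1 ∧ FrameRel R 8 b 1 := by
        rcases (hab c).1 hc with rfl | rfl <;> tauto
      have : 2 * (r ⬝ₑ r') = 0 := by
        rw [← form_smul_left, h2, form_add_left, form_smul_left, form_smul_left, form_comm _ r',
          form_comm _ r', hz a hab'.1, hz b hab'.2]
        ring
      omega
  have hdiff : ∀ a b : Fin 9, m ≤ a.val → m ≤ b.val → ∀ e, (2 : ℤ) • e = frame a - frame b →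
      e ∈ R := by
    intro a b ha hb e he
    obtain ⟨x, hx, h⟩ := hrel a ha
    obtain ⟨x', hx', h'⟩ := hrel b hb
    convert R.sub_mem hx' hx
    apply two_smul_injective
    rw [smul_sub, h, h', he]
    module
  have h7 : simpleRoot 7 ∈ R := hdiff 7 8 (by simp; omega) (by simp; omega) _ (by decide +kernel)
  intro j hj
  by_cases hj9 : j = 9
  · subst hj9
    have := R.add_mem h7 (hF 8 (by simp; omega))
    rwa [show simpleRoot 7 + frame 8 = simpleRoot 9 by decide +kernel] at this
  · obtain ⟨hj1, hj8⟩ := (hJm j).1 hj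
    have hsimple : ∀ k : Fin 8,
        (2 : ℤ) • simpleRoot (k.castSucc.castSucc) = frame k.castSucc - frame k.succ := by
      decide +kernel
    have hje : j.val < 8 := by
      rw [Ne, Fin.ext_iff] at hj8
      rw [Fin.ext_iff] at hj9
      simp at hj8 hj9
      omega
    exact hdiff _ _ (by simpa using hj1) (by simp; omega) _ (hsimple ⟨j, hje⟩)

/-! ### Liftability for `A₈`, `D₈` and `D₉` -/

theorem exists_red_eq_add_weight {R : Submodule ℤ E10} {J : Set (Fin 10)}
    (hmem : ∀ j ∈ J, simpleRoot j ∈ R) {h : V10 →ₗ[ZMod 2] V10} (hq : PreservesQ h)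
    (hfix : ∀ r ∈ R, h (red r) = red r) (x : E10) :
    ∃ c : Fin 10 → ℤ, (∀ j ∈ J, c j = 0) ∧ h (red x) = red (x + ∑ k, c k • weight k) := by
  classical
  obtain ⟨x', hx'⟩ := red_surjective (h (red x))
  refine ⟨fun k => if k ∈ J then 0 else (x' - x) ⬝ₑ simpleRoot k, fun j hj => if_pos hj, ?_⟩
  have : red (x' - x) =
      red (∑ k, (if k ∈ J then 0 else (x' - x) ⬝ₑ simpleRoot k) • weight k) := by
    conv_lhs => rw [eq_sum_weight (x' - x)]
    rw [red_sum, red_sum]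
    refine Finset.sum_congr rfl fun k _ => ?_
    by_cases hk : k ∈ J
    · have h2 := form_lift_parity hq hx' (hfix _ (hmem k hk)).symm
      rw [← form_sub_left] at h2
      rw [if_pos hk, red_smul, red_smul, (ZMod.intCast_zmod_eq_zero_iff_dvd _ 2).2 h2,
        Int.cast_zero]
    · rw [if_neg hk]
  rw [red_add, ← this, ← red_add, add_sub_cancel, hx']

theorem red_eq_of_simpleRoot {g : E10 →ₗ[ℤ] E10} {h : V10 →ₗ[ZMod 2] V10}
    (hgh : ∀ i, red (g (simpleRoot i)) = h (red (simpleRoot i))) (x : E10) :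
    red (g x) = h (red x) := by
  rw [eq_sum_simpleRoot x, map_sum, red_sum, red_sum, map_sum]
  refine Finset.sum_congr rfl fun i _ => ?_
  rw [map_smul, red_smul, red_smul, map_smul, hgh]

theorem red_eq_of_simpleRoot_mem {R : Submodule ℤ E10} {J : Set (Fin 10)}
    (hmem : ∀ j ∈ J, simpleRoot j ∈ R) {g : E10 →ₗ[ℤ] E10} {h : V10 →ₗ[ZMod 2] V10}
    (hfix : ∀ r ∈ R, h (red r) = red r) (hgR : ∀ r ∈ R, g r = r)
    (hgh : ∀ i ∉ J, red (g (simpleRoot i)) = h (red (simpleRoot i))) (x : E10) :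
    red (g x) = h (red x) :=
  red_eq_of_simpleRoot (fun i => by
    by_cases hi : i ∈ J
    · rw [hgR _ (hmem i hi), hfix _ (hmem i hi)]
    · exact hgh i hi) x

theorem red_add_even_smul {c : ℤ} (hc : 2 ∣ c) (x y : E10) : red (x + c • y) = red x := by
  obtain ⟨d, rfl⟩ := hc
  exact red_eq_red_iff.2 ⟨d • y, by rw [mul_smul]⟩

theorem red_add_odd_smul {c : ℤ} (hc : ¬ 2 ∣ c) (x y : E10) : red (x + c • y) = red (x + y) := by
  obtain ⟨d, hd⟩ : ∃ d, c = 1 + 2 * d := ⟨c / 2, by omega⟩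
  exact red_eq_red_iff.2 ⟨d • y, by rw [hd]; module⟩

theorem isLiftable_of_chain_seven {R : Submodule ℤ E10} {J : Set (Fin 10)}
    (hJ : IsSupportedOn R J) (hmem : ∀ j ∈ J, simpleRoot j ∈ R) (hJ7 : ∀ i, i ∈ J ↔ i.val < 8) :
    IsLiftable R := by
  intro h hq hfix _
  have hsum : ∀ c : Fin 10 → ℤ, (∀ j ∈ J, c j = 0) →
      ∑ k, c k • weight k = c 8 • weight 8 + c 9 • weight 9 := fun c hc => by
    rw [← Finset.sum_pair (f := fun k => c k • weight k) (by decide : (8 : Fin 10) ≠ 9)]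
    refine (Finset.sum_subset (Finset.subset_univ _) fun k _ hk => ?_).symm
    rw [hc k, zero_smul]
    simp only [Finset.mem_insert, Finset.mem_singleton, Fin.ext_iff, not_or] at hk
    rw [hJ7]
    simp at hk
    omega
  have e88 : weight 8 ⬝ₑ weight 8 = 4 := by decide +kernel
  have e99 : weight 9 ⬝ₑ weight 9 = 10 := by decide +kernel
  have e89 : weight 8 ⬝ₑ weight 9 = 7 := by decide +kernel
  have e98 : weight 9 ⬝ₑ weight 8 = 7 := by decide +kernel
  have s88 : simpleRoot 8 ⬝ₑ weight 8 = 1 := by decide +kernel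
  have s89 : simpleRoot 8 ⬝ₑ weight 9 = 0 := by decide +kernel
  have s98 : simpleRoot 9 ⬝ₑ weight 8 = 0 := by decide +kernel
  have s99 : simpleRoot 9 ⬝ₑ weight 9 = 1 := by decide +kernel
  have r98 : simpleRoot 9 ⬝ₑ simpleRoot 8 = 0 := by decide +kernel
  obtain ⟨c, hc, h8⟩ := exists_red_eq_add_weight hmem hq hfix (simpleRoot 8)
  obtain ⟨d, hd, h9⟩ := exists_red_eq_add_weight hmem hq hfix (simpleRoot 9)
  rw [hsum c hc] at h8
  rw [hsum d hd] at h9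
  have h88 := form_self_lift hq h8.symm
  have h8' : h (red (simpleRoot 8)) = red (simpleRoot 8) := by
    simp only [form_add_left, form_add_right, form_smul_left, form_smul_right,
      form_comm (weight _) (simpleRoot 8), e88, e99, e89, e98, s88, s89] at h88
    obtain ⟨p, hp⟩ :
        ∃ p, 2 * c 8 + 4 * (c 8 * c 8) + 10 * (c 9 * c 9) + 14 * (c 8 * c 9) = 4 * p := by
      obtain ⟨p, hp⟩ := h88
      exact ⟨p, by linarith⟩
    have : 2 ∣ c 8 ∧ 2 ∣ c 9 := by
      rcases Int.even_or_odd' (c 8) with ⟨m, hm | hm⟩ <;>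
        rcases Int.even_or_odd' (c 9) with ⟨n, hn | hn⟩ <;> rw [hm, hn] at hp ⊢ <;>
        ring_nf at hp <;> omega
    rw [h8, ← add_assoc, red_add_even_smul this.2, red_add_even_smul this.1]
  have h98 := form_lift_parity hq h9.symm h8'.symm
  have hd8 : 2 ∣ d 8 := by
    simp only [form_add_left, form_smul_left, r98,
      form_comm (weight _) (simpleRoot 8), s88, s89] at h98
    omega
  have h9' : h (red (simpleRoot 9)) = red (simpleRoot 9 + d 9 • weight 9) := by
    rw [h9, add_left_comm, add_comm, red_add_even_smul hd8]
  by_cases hd9 : 2 ∣ d 9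
  · refine ⟨LinearMap.id, preservesForm_id, fun r _ => rfl,
      red_eq_of_simpleRoot_mem hmem hfix (fun r _ => rfl) fun i hi => ?_⟩
    rw [LinearMap.id_apply]
    obtain rfl | rfl : i = 8 ∨ i = 9 := by rw [hJ7] at hi; omega
    · rw [h8']
    · rw [h9', red_add_even_smul hd9]
  · have hR : ∀ r ∈ R, rootReflection ((2 : ℤ) • weight 8 - weight 9) r = r := fun r hr => by
      have h8 : r 8 = 0 := hJ.apply_eq_zero r hr 8 (by simp [hJ7])
      have h9 : r 9 = 0 := hJ.apply_eq_zero r hr 9 (by simp [hJ7])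
      rw [rootReflection_apply, form_sub_right, form_smul_right, form_weight, form_weight, h8, h9]
      simp
    refine ⟨_, rootReflection_preservesForm (by decide +kernel), hR,
      red_eq_of_simpleRoot_mem hmem hfix hR fun i hi => ?_⟩
    rw [rootReflection_apply, form_sub_right, form_smul_right]
    obtain rfl | rfl : i = 8 ∨ i = 9 := by rw [hJ7] at hi; omega
    · rw [h8', s88, s89, red_add_even_smul (by norm_num)]
    · rw [h9', red_add_odd_smul hd9, s98, s99, red_eq_red_iff]
      exact ⟨-weight 8, by module⟩

theorem isLiftable_of_fork_eight {R : Submodule ℤ E10} {J : Set (Fin 10)}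
    (hmem : ∀ j ∈ J, simpleRoot j ∈ R) (hJ8 : ∀ i, i ∈ J ↔ i ≠ 8) : IsLiftable R := by
  intro h hq hfix _
  obtain ⟨c, hc, h8⟩ := exists_red_eq_add_weight hmem hq hfix (simpleRoot 8)
  rw [Finset.sum_eq_single 8 (fun k _ hk => by rw [hc k ((hJ8 k).2 hk), zero_smul]) (by simp)] at h8
  have e88 : weight 8 ⬝ₑ weight 8 = 4 := by decide +kernel
  have s88 : simpleRoot 8 ⬝ₑ weight 8 = 1 := by decide +kernel
  have h88 := form_self_lift hq h8.symm
  simp only [form_add_left, form_add_right, form_smul_left, form_smul_right,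
    form_comm (weight _) (simpleRoot 8), e88, s88] at h88
  have hc8 : 2 ∣ c 8 := by
    obtain ⟨p, hp⟩ := h88
    exact ⟨p - c 8 * c 8, by linarith⟩
  refine ⟨LinearMap.id, preservesForm_id, fun r _ => rfl,
    red_eq_of_simpleRoot_mem hmem hfix (fun r _ => rfl) fun i hi => ?_⟩
  obtain rfl : i = 8 := by rwa [hJ8, not_not] at hi
  rw [LinearMap.id_apply, h8, red_add_even_smul hc8]

/-- Negation on the span of the isotropic vectors `u` and `v` with `u·v = 2`. -/
def planeNegation (u v : E10) : E10 →ₗ[ℤ] E10 :=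
  LinearMap.id - (formRight v).smulRight u - (formRight u).smulRight v

theorem planeNegation_apply (u v x : E10) :
    planeNegation u v x = x - (x ⬝ₑ v) • u - (x ⬝ₑ u) • v := rfl

theorem planeNegation_preservesForm {u v : E10} (hu : u ⬝ₑ u = 0) (hv : v ⬝ₑ v = 0)
    (huv : u ⬝ₑ v = 2) : PreservesForm (planeNegation u v) := by
  intro a b
  simp only [planeNegation_apply, form_sub_left, form_sub_right, form_smul_left, form_smul_right,
    hu, hv, huv, form_comm v u, form_comm u b, form_comm v b]
  ring

theorem isLiftable_of_fork_seven {R : Submodule ℤ E10} {J : Set (Fin 10)}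
    (hJ : IsSupportedOn R J) (hmem : ∀ j ∈ J, simpleRoot j ∈ R)
    (hJ08 : ∀ i, i ∈ J ↔ i ≠ 0 ∧ i ≠ 8) : IsLiftable R := by
  intro h hq hfix _
  have hsum : ∀ c : Fin 10 → ℤ, (∀ j ∈ J, c j = 0) →
      ∑ k, c k • weight k = c 0 • weight 0 + c 8 • weight 8 := fun c hc => by
    rw [← Finset.sum_pair (f := fun k => c k • weight k) (by decide : (0 : Fin 10) ≠ 8)]
    refine (Finset.sum_subset (Finset.subset_univ _) fun k _ hk => ?_).symm
    simp only [Finset.mem_insert, Finset.mem_singleton, not_or] at hk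
    rw [hc k ((hJ08 k).2 hk), zero_smul]
  have e00 : weight 0 ⬝ₑ weight 0 = 0 := by decide +kernel
  have e88 : weight 8 ⬝ₑ weight 8 = 4 := by decide +kernel
  have e08 : weight 0 ⬝ₑ weight 8 = 2 := by decide +kernel
  have e80 : weight 8 ⬝ₑ weight 0 = 2 := by decide +kernel
  have s00 : simpleRoot 0 ⬝ₑ weight 0 = 1 := by decide +kernel
  have s08 : simpleRoot 0 ⬝ₑ weight 8 = 0 := by decide +kernel
  have s80 : simpleRoot 8 ⬝ₑ weight 0 = 0 := by decide +kernel
  have s88 : simpleRoot 8 ⬝ₑ weight 8 = 1 := by decide +kernel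
  have r08 : simpleRoot 0 ⬝ₑ simpleRoot 8 = 0 := by decide +kernel
  obtain ⟨c, hc, h0⟩ := exists_red_eq_add_weight hmem hq hfix (simpleRoot 0)
  obtain ⟨d, hd, h8⟩ := exists_red_eq_add_weight hmem hq hfix (simpleRoot 8)
  rw [hsum c hc] at h0
  rw [hsum d hd] at h8
  have h0' : h (red (simpleRoot 0)) = red (simpleRoot 0 + c 8 • weight 8) := by
    have h00 := form_self_lift hq h0.symm
    simp only [form_add_left, form_add_right, form_smul_left, form_smul_right,
      form_comm (weight _) (simpleRoot 0), e00, e88, e08, e80, s00, s08] at h00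
    have : 2 ∣ c 0 := by
      obtain ⟨p, hp⟩ := h00
      exact ⟨p - c 8 * c 8 - c 0 * c 8, by linarith⟩
    rw [h0, add_left_comm, add_comm, red_add_even_smul this]
  have h8' : h (red (simpleRoot 8)) = red (simpleRoot 8 + d 0 • weight 0) := by
    have h88 := form_self_lift hq h8.symm
    simp only [form_add_left, form_add_right, form_smul_left, form_smul_right,
      form_comm (weight _) (simpleRoot 8), e00, e88, e08, e80, s80, s88] at h88
    have : 2 ∣ d 8 := by
      obtain ⟨p, hp⟩ := h88
      exact ⟨p - d 8 * d 8 - d 0 * d 8, by linarith⟩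
    rw [h8, ← add_assoc, red_add_even_smul this]
  have hpar : 2 ∣ c 8 + d 0 := by
    have := form_lift_parity hq h0'.symm h8'.symm
    simp only [form_add_left, form_add_right, form_smul_left, form_smul_right,
      form_comm (weight _) (simpleRoot 8), e80, s00, s88, r08] at this
    obtain ⟨p, hp⟩ := this
    exact ⟨p - c 8 * d 0, by linarith⟩
  have hcases : ∀ i ∉ J, i = 0 ∨ i = 8 := fun i hi => by rw [hJ08] at hi; tauto
  by_cases hc8 : 2 ∣ c 8
  · refine ⟨LinearMap.id, preservesForm_id, fun r _ => rfl,
      red_eq_of_simpleRoot_mem hmem hfix (fun r _ => rfl) fun i hi => ?_⟩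
    rw [LinearMap.id_apply]
    obtain rfl | rfl := hcases i hi
    · rw [h0', red_add_even_smul hc8]
    · rw [h8', red_add_even_smul (by omega)]
  · have hR : ∀ r ∈ R, planeNegation (weight 0) (weight 8 - weight 0) r = r := fun r hr => by
      have h0 : r 0 = 0 := hJ.apply_eq_zero r hr 0 (by simp [hJ08])
      have h8 : r 8 = 0 := hJ.apply_eq_zero r hr 8 (by simp [hJ08])
      rw [planeNegation_apply, form_sub_right, form_weight, form_weight, h0, h8]
      simp
    refine ⟨_, planeNegation_preservesForm (by decide +kernel) (by decide +kernel)
      (by decide +kernel), hR, red_eq_of_simpleRoot_mem hmem hfix hR fun i hi => ?_⟩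
    rw [planeNegation_apply, form_sub_right]
    obtain rfl | rfl := hcases i hi
    · rw [h0', red_add_odd_smul hc8, s00, s08, red_eq_red_iff]
      exact ⟨weight 0 - weight 8, by module⟩
    · rw [h8', red_add_odd_smul (by omega), s80, s88, red_eq_red_iff]
      exact ⟨-weight 0, by module⟩

/-! ### The classification of irreducible root sublattices -/

theorem isLiftable_of_chain_eight {R : Submodule ℤ E10} {J : Set (Fin 10)}
    (hJ : IsSupportedOn R J) (hR : IsIrreducibleRootLattice R) (hJ7 : ∀ i, i ∈ J ↔ i.val < 8) :
    IsLiftable R ∧ ∀ r ∈ R, r 8 = 0 :=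
  ⟨isLiftable_of_chain_seven hJ (hJ.simpleRoot_mem_of_chain hR (by norm_num) hJ7) hJ7,
    fun r hr => hJ.apply_eq_zero r hr 8 (by simp [hJ7])⟩

theorem isLiftable_or_chain {R : Submodule ℤ E10} (hR : IsIrreducibleRootLattice R)
    (hneg : ∀ x ∈ R, x ≠ 0 → x ⬝ₑ x < 0) :
    ∃ g : E10 →ₗ[ℤ] E10, PreservesForm g ∧
      (IsLiftable (R.map g) ∧ ((∀ r ∈ R.map g, r 1 = 0) ∨ ∀ r ∈ R.map g, r 8 = 0) ∨
      (∀ i : Fin 10, i ≠ 9 → simpleRoot i ∈ R.map g) ∧ ∀ r ∈ R.map g, r 9 = 0) := by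
  obtain ⟨g, x, hg, hx, -, hJ⟩ := exists_isSupportedOn hR hneg
  obtain ⟨J, hJx⟩ : ∃ J : Set (Fin 10), ∀ i, i ∈ J ↔ x ⬝ₑ simpleRoot i = 0 := ⟨_, fun _ => Iff.rfl⟩
  rw [show {i | x ⬝ₑ simpleRoot i = 0} = J from Set.ext fun i => (hJx i).symm] at hJ
  have hRg := hR.map hg
  have moved : ∀ {g' : E10 →ₗ[ℤ] E10}, PreservesForm g' →
      IsLiftable ((R.map g).map g') ∧ (∀ r ∈ (R.map g).map g', r 8 = 0) →
      ∃ g : E10 →ₗ[ℤ] E10, PreservesForm g ∧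
        (IsLiftable (R.map g) ∧ ((∀ r ∈ R.map g, r 1 = 0) ∨ ∀ r ∈ R.map g, r 8 = 0) ∨
        (∀ i : Fin 10, i ≠ 9 → simpleRoot i ∈ R.map g) ∧ ∀ r ∈ R.map g, r 9 = 0) := by
    intro g' hg' h
    rw [← Submodule.map_comp] at h
    exact ⟨_, hg'.comp hg, .inl ⟨h.1, .inr h.2⟩⟩
  rcases IsSupportedOn.subdiagram hRg hx hJx hJ with ⟨K, hK, hJK⟩ | ⟨K, hK, hJK⟩
  · obtain ⟨g', hg', h⟩ := hJ.exists_orthogonal_plane hK hJK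
    have hlift := isLiftable_of_orthogonal_plane (hRg.map hg') h
    rw [← Submodule.map_comp] at h hlift
    exact ⟨_, hg'.comp hg, .inl ⟨hlift, .inl fun r hr => (h r hr).2⟩⟩
  · have hKJ : ∀ {σ : Fin 10 → Fin 10}, ∀ i,
        i ∈ σ '' J ↔ ∃ k ∈ K, σ k = i := fun {σ} i => by
      simp only [Set.mem_image, hJK]
    simp only [largeSubdiagrams, List.mem_cons, List.not_mem_nil, or_false] at hK
    rcases hK with rfl | rfl | rfl | rfl | rfl | rfl
    · refine ⟨g, hg, .inl ?_⟩
      have := isLiftable_of_chain_eight hJ hRg fun i => (hJK i).trans (by revert i; decide)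
      exact ⟨this.1, .inr this.2⟩
    · obtain ⟨g', hg', hσ⟩ := exists_isometry_chain_one_eight
      exact moved hg' (isLiftable_of_chain_eight (hJ.map hg' (fun i hi => hσ i ((hJK i).1 hi)) rfl)
        (hRg.map hg') fun i => (hKJ i).trans (by revert i; decide))
    · obtain ⟨g', hg', hσ⟩ := exists_isometry_chain_zero_six_nine
      exact moved hg' (isLiftable_of_chain_eight (hJ.map hg' (fun i hi => hσ i ((hJK i).1 hi)) rfl)
        (hRg.map hg') fun i => (hKJ i).trans (by revert i; decide))
    · have hmem := hJ.simpleRoot_mem_of_fork hRg (le_refl 1) fun i =>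
        (hJK i).trans (by revert i; decide)
      exact ⟨g, hg, .inl ⟨isLiftable_of_fork_seven hJ hmem fun i =>
        (hJK i).trans (by revert i; decide), .inr fun r hr => hJ.apply_eq_zero r hr 8
          fun h => by rw [hJK] at h; simp at h⟩⟩
    · have hmem := hJ.simpleRoot_mem_of_fork hRg zero_le_one fun i =>
        (hJK i).trans (by revert i; decide)
      exact ⟨g, hg, .inl ⟨isLiftable_of_fork_eight hmem fun i =>
        (hJK i).trans (by revert i; decide), .inr fun r hr => hJ.apply_eq_zero r hr 8
          fun h => by rw [hJK] at h; simp at h⟩⟩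
    · have hmem := hJ.simpleRoot_mem_of_chain hRg (le_refl 9) fun i =>
        (hJK i).trans (by revert i; decide)
      exact ⟨g, hg, .inr ⟨fun i hi => hmem i ((hJK i).2 (by revert i; decide)),
        fun r hr => hJ.apply_eq_zero r hr 9 fun h => by rw [hJK] at h; simp at h⟩⟩

/-- The Gram matrix of the orthogonal sum of `A₉` and a vector of square `c`. -/
def a9SumGram (c : ℤ) : Matrix (Fin 10) (Fin 10) ℤ :=
  of fun i j => if i = j then if i = 9 then c else -2
    else if (i.val + 1 = j.val ∧ j.val < 9) ∨ (j.val + 1 = i.val ∧ i.val < 9) then 1 else 0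

/-- An upper triangular matrix clearing the part of `a9SumGram` above the diagonal. -/
def a9Clearing : Matrix (Fin 10) (Fin 10) ℤ :=
  of fun i j => if j = 9 then if i = 9 then 1 else 0 else if i ≤ j then (i.val : ℤ) + 1 else 0

theorem det_a9SumGram {c : ℤ} (hc : c = 2 ∨ c = 4) : (a9SumGram c).det = -10 * c := by
  have hT : a9Clearing.det = 362880 := by
    rw [det_of_isUpperTriangular fun i j (hij : j < i) => ?_]
    · decide +kernel
    · have h9 : j ≠ 9 := by omega
      simp [a9Clearing, h9, hij.not_ge]
  have hL : (a9SumGram c * a9Clearing).det = -3628800 * c := by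
    have key : ∀ i j : Fin 10, i < j → (a9SumGram c * a9Clearing) i j = 0 := by
      rcases hc with rfl | rfl <;> simp only [a9SumGram, a9Clearing, mul_apply, of_apply] <;>
        decide +kernel
    rw [det_of_isLowerTriangular _ fun i j (hij : i < j) => key i j hij]
    rcases hc with rfl | rfl <;> decide +kernel
  rw [det_mul, hT] at hL
  omega

theorem e10Gram_det : e10Gram.det = 1 ∨ e10Gram.det = -1 := by
  have := congrArg det e10Gram_mul_inv
  rw [det_mul, det_one] at this
  exact Int.isUnit_iff.1 (IsUnit.of_mul_eq_one _ this)

theorem not_isometricToA9 {R : Submodule ℤ E10} {w : E10} (hw : w ⬝ₑ w = 2 ∨ w ⬝ₑ w = 4)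
    (hwR : ∀ r ∈ R, r ⬝ₑ w = 0) : ¬ IsometricToA9 R := by
  rintro ⟨f, -, hfR, hf⟩
  obtain ⟨v, hvc, hvl⟩ : ∃ v : Fin 10 → E10,
      (∀ i : Fin 9, v i.castSucc = f (Pi.single i 1)) ∧ v (Fin.last 9) = w :=
    ⟨Fin.snoc (α := fun _ => E10) (fun i : Fin 9 => f (Pi.single i 1)) w,
      fun i => Fin.snoc_castSucc (α := fun _ => E10) _ _ i, Fin.snoc_last (α := fun _ => E10) _ _⟩
  have hfw : ∀ x, f x ⬝ₑ w = 0 := fun x => hwR _ (hfR ▸ LinearMap.mem_range_self f _)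
  let N : Matrix (Fin 10) (Fin 10) ℤ := of v
  have hN : N * e10Gram * Nᵀ = a9SumGram (w ⬝ₑ w) := by
    ext i j
    have hij : (N * e10Gram * Nᵀ) i j = v i ⬝ₑ v j := by
      rw [e10Form, dotProduct_mulVec]
      rfl
    rw [hij]
    refine Fin.lastCases ?_ (fun i => ?_) i <;> refine Fin.lastCases ?_ (fun j => ?_) j
    · rw [hvl]
      simp [a9SumGram]
    · rw [hvl, hvc, form_comm, hfw]
      simp only [a9SumGram, of_apply, Fin.ext_iff, Fin.val_last, Fin.val_castSucc]
      rw [if_neg (by omega), if_neg (by omega)]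
    · rw [hvl, hvc, hfw]
      simp only [a9SumGram, of_apply, Fin.ext_iff, Fin.val_last, Fin.val_castSucc]
      rw [if_neg (by omega), if_neg (by omega)]
    · rw [hvc, hvc, hf, mulVec_single_one, single_one_dotProduct, col_apply]
      generalize w ⬝ₑ w = c
      clear * -
      have h9 : i.castSucc ≠ 9 := Fin.castSucc_ne_last i
      have hi := i.isLt
      have hj := j.isLt
      simp only [a9SumGram, a9Gram, of_apply, Fin.val_castSucc, Fin.castSucc_inj, h9, if_false]
      simp only [show (j.val < 9) = True from eq_true hj, show (i.val < 9) = True from eq_true hi,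
        and_true]
  have h := congrArg det hN
  rw [det_mul, det_mul, det_transpose, det_a9SumGram hw] at h
  have hsq : N.det * N.det = 20 ∨ N.det * N.det = 40 := by
    have hpos := mul_self_nonneg N.det
    rcases e10Gram_det with h' | h' <;> rcases hw with hw | hw <;> rw [h', hw] at h <;>
      first | (left; linarith) | (right; linarith)
  have h7 : N.det < 7 := by rcases hsq with h | h <;> nlinarith
  have h8 : -7 < N.det := by rcases hsq with h | h <;> nlinarith
  generalize N.det = d at *
  interval_cases d <;> omega

/-- The data of an `A₉` sublattice `R` relevant for isometries of `E₁₀ ⊗ F₂` fixing `R`: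
they are trivial or the transvection-like map `x ↦ x + (x·w)w`. -/
structure IsChainNine (R : Submodule ℤ E10) (w : E10) : Prop where
  form_self : w ⬝ₑ w = 10
  form_eq_zero : ∀ r ∈ R, r ⬝ₑ w = 0
  exists_form_eq_one : ∃ x, x ⬝ₑ w = 1
  reduction_eq : ∀ h : V10 →ₗ[ZMod 2] V10, PreservesQ h → (∀ r ∈ R, h (red r) = red r) →
    (∀ x, h (red x) = red x) ∨ ∀ x, h (red x) = red (x + (x ⬝ₑ w) • w)
  eq_id : ∀ g : E10 →ₗ[ℤ] E10, PreservesForm g → (∀ r ∈ R, g r = r) → ∀ x, g x = x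
  isometric : IsometricToA9 R

theorem isometricToA9_of_simpleRoot_mem {R : Submodule ℤ E10}
    (hmem : ∀ i, i ≠ 9 → simpleRoot i ∈ R) (hzero : ∀ r ∈ R, r 9 = 0) : IsometricToA9 R := by
  let f : (Fin 9 → ℤ) →ₗ[ℤ] E10 := LinearMap.pi
    (Fin.snoc (α := fun _ => (Fin 9 → ℤ) →ₗ[ℤ] ℤ) (fun i : Fin 9 => LinearMap.proj i) 0)
  have hc : ∀ x (i : Fin 9), f x i.castSucc = x i := fun x i => by
    simp [f]
  have hl : ∀ x, f x (Fin.last 9) = 0 := fun x => by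
    simp [f, -Fin.reduceLast]
  refine ⟨f, fun x y hxy => ?_, le_antisymm ?_ fun r hr => ⟨fun i => r i.castSucc, ?_⟩,
    fun x y => ?_⟩
  · ext i
    rw [← hc x, hxy, hc]
  · rintro _ ⟨x, rfl⟩
    rw [eq_sum_simpleRoot (f x)]
    refine Submodule.sum_mem _ fun i _ => ?_
    by_cases hi : i = 9
    · rw [hi, show f x 9 = 0 from hl x, zero_smul]
      exact R.zero_mem
    · exact R.smul_mem _ (hmem i hi)
  · have hG : ∀ i j : Fin 9, e10Gram i.castSucc j.castSucc = a9Gram i j := by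
      simp only [e10Gram, a9Gram, of_apply]
      decide +kernel
    simp only [e10Form, dotProduct, mulVec, Fin.sum_univ_castSucc (n := 9), hc, hl, hG, mul_zero,
      zero_mul, add_zero]
  · ext i
    refine Fin.lastCases ?_ (fun i => ?_) i
    · rw [hl]
      exact (hzero r hr).symm
    · rw [hc]

theorem isChainNine_of_simpleRoot_mem {R : Submodule ℤ E10}
    (hmem : ∀ i, i ≠ 9 → simpleRoot i ∈ R) (hzero : ∀ r ∈ R, r 9 = 0) :
    IsChainNine R (weight 9) where
  form_self := by
    rw [form_weight, weight_apply]
    decide +kernel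
  form_eq_zero r hr := by rw [form_weight, hzero r hr]
  exists_form_eq_one := ⟨simpleRoot 9, by rw [form_weight]; simp [simpleRoot]⟩
  isometric := isometricToA9_of_simpleRoot_mem hmem hzero
  reduction_eq h hq hfix := by
    obtain ⟨c, hc, hcs⟩ := exists_red_eq_add_weight (J := {i | i ≠ 9}) hmem hq hfix (simpleRoot 9)
    rw [Finset.sum_eq_single 9 (fun i _ hi => by rw [hc i hi, zero_smul]) (by simp)] at hcs
    have h9 : simpleRoot 9 ⬝ₑ weight 9 = 1 := by
      rw [form_weight]
      simp [simpleRoot]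
    rcases Int.even_or_odd (c 9) with h2 | h2
    · left
      intro x
      refine (red_eq_of_simpleRoot_mem (J := {i | i ≠ 9}) (g := LinearMap.id) hmem hfix
        (fun r _ => rfl) (fun i hi => ?_) x).symm
      obtain rfl : i = 9 := by simpa using hi
      rw [hcs, red_add_even_smul h2.two_dvd]
      rfl
    · right
      rw [Int.odd_iff] at h2
      intro x
      refine (red_eq_of_simpleRoot_mem (J := {i | i ≠ 9})
        (g := LinearMap.id + (formRight (weight 9)).smulRight (weight 9)) hmem hfix
        (fun r hr => ?_) (fun i hi => ?_) x).symm
      · simp [formRight_apply, form_weight, hzero r hr]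
      · obtain rfl : i = 9 := by simpa using hi
        rw [hcs, red_add_odd_smul (by omega)]
        simp only [LinearMap.add_apply, LinearMap.id_apply, LinearMap.smulRight_apply,
          formRight_apply, h9, one_smul]
  eq_id g hg hfix x := by
    have h9 : simpleRoot 9 ⬝ₑ weight 9 = 1 := by
      rw [form_weight]
      simp [simpleRoot]
    have h99 : weight 9 ⬝ₑ weight 9 = 10 := by
      rw [form_weight, weight_apply]
      decide +kernel
    have hne : ∀ i, i ≠ 9 → (g (simpleRoot 9) - simpleRoot 9) ⬝ₑ simpleRoot i = 0 := fun i hi => by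
      have := hg (simpleRoot 9) (simpleRoot i)
      rw [hfix _ (hmem i hi)] at this
      rw [form_sub_left, this, sub_self]
    have hd := eq_sum_weight (g (simpleRoot 9) - simpleRoot 9)
    rw [Finset.sum_eq_single 9 (fun i _ hi => by rw [hne i hi, zero_smul]) (by simp)] at hd
    generalize (g (simpleRoot 9) - simpleRoot 9) ⬝ₑ simpleRoot 9 = c at hd
    have hg9 : g (simpleRoot 9) = simpleRoot 9 + c • weight 9 := by rw [← hd]; abel
    have hself := hg (simpleRoot 9) (simpleRoot 9)
    rw [hg9, form_add_left, form_add_right, form_add_right, form_smul_left, form_smul_left,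
      form_smul_right, form_smul_right, form_comm (weight 9) (simpleRoot 9), h9, h99] at hself
    have hc : c = 0 := by
      have : c * (10 * c + 2) = 0 := by linarith
      rcases mul_eq_zero.1 this with h | h
      · exact h
      · omega
    rw [hc, zero_smul, add_zero] at hg9
    have hall : ∀ i, g (simpleRoot i) = simpleRoot i := fun i => by
      by_cases hi : i = 9
      · rw [hi, hg9]
      · exact hfix _ (hmem i hi)
    conv_lhs => rw [eq_sum_simpleRoot x]
    conv_rhs => rw [eq_sum_simpleRoot x]
    simp only [map_sum, map_smul, hall]

theorem IsChainNine.of_map {R : Submodule ℤ E10} {e : E10 ≃ₗ[ℤ] E10} {w : E10}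
    (he : PreservesForm (e : E10 →ₗ[ℤ] E10))
    (hR : IsChainNine (R.map (e : E10 →ₗ[ℤ] E10)) w) : IsChainNine R (e.symm w) := by
  have hew : ∀ x, x ⬝ₑ e.symm w = e x ⬝ₑ w := fun x => by
    have := he x (e.symm w)
    simpa using this.symm
  have hmem : ∀ r ∈ R, e r ∈ R.map (e : E10 →ₗ[ℤ] E10) := fun r hr => ⟨r, hr, rfl⟩
  refine ⟨?_, fun r hr => ?_, ?_, fun h hq hfix => ?_, fun g hg hfix x => ?_, ?_⟩
  · rw [hew, e.apply_symm_apply, hR.form_self]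
  · rw [hew, hR.form_eq_zero _ (hmem r hr)]
  · obtain ⟨x, hx⟩ := hR.exists_form_eq_one
    exact ⟨e.symm x, by rw [hew, e.apply_symm_apply, hx]⟩
  · obtain ⟨k, hk, hek⟩ := he.exists_reduction
    have hek' : ∀ x, k.symm (red x) = red (e.symm x) := fun x => by
      rw [LinearEquiv.symm_apply_eq, ← hek, LinearEquiv.apply_symm_apply]
    have hk' : PreservesQ (k.symm : V10 →ₗ[ZMod 2] V10) := fun v => by
      have := hk (k.symm v)
      simpa using this.symm
    have hconj : ∀ x, h (red x) = k.symm (((k : V10 →ₗ[ZMod 2] V10) ∘ₗ h ∘ₗ k.symm) (red (e x))) :=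
      fun x => by
        simp [hek]
    refine (hR.reduction_eq ((k : V10 →ₗ[ZMod 2] V10) ∘ₗ h ∘ₗ k.symm)
      (fun v => ?_) ?_).imp (fun H x => ?_) fun H x => ?_
    · exact (hk _).trans ((hq _).trans (hk' v))
    · rintro _ ⟨r, hr, rfl⟩
      simp [hek, hfix r hr]
    · rw [hconj, H, hek', e.symm_apply_apply]
    · rw [hconj, H, hek', map_add, map_smul, e.symm_apply_apply, hew]
  · have := hR.eq_id ((e : E10 →ₗ[ℤ] E10) ∘ₗ g ∘ₗ e.symm) (he.comp (hg.comp he.symm)) (by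
      rintro _ ⟨r, hr, rfl⟩
      simp [hfix r hr]) (e x)
    simpa using this
  · obtain ⟨f, hf, hfR, hform⟩ := hR.isometric
    refine ⟨(e.symm : E10 →ₗ[ℤ] E10) ∘ₗ f, e.symm.injective.comp hf, ?_, fun x y => ?_⟩
    · rw [LinearMap.range_comp, hfR, ← Submodule.map_comp]
      simp
    · rw [← hform]
      exact he.symm _ _

theorem exists_twist {w : E10} (hw : w ⬝ₑ w = 10) : ∃ τ : V10 ≃ₗ[ZMod 2] V10,
    PreservesQ (τ : V10 →ₗ[ZMod 2] V10) ∧ ∀ x, τ (red x) = red (x + (x ⬝ₑ w) • w) := by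
  obtain ⟨τ, hτ⟩ := exists_reduction_linearMap
    (LinearMap.id + (formRight w).smulRight w : E10 →ₗ[ℤ] E10)
  have hτ' : ∀ x, τ (red x) = red (x + (x ⬝ₑ w) • w) := fun x => (hτ x).symm
  have hq : PreservesQ τ := fun v => by
    obtain ⟨x, rfl⟩ := red_surjective v
    rw [hτ', q2_eq_q2_iff, form_add_left, form_add_right, form_add_right, form_smul_left,
      form_smul_left, form_smul_right, form_smul_right, form_comm w x, hw]
    exact ⟨3 * (x ⬝ₑ w * (x ⬝ₑ w)), by ring⟩
  exact ⟨LinearEquiv.ofInjectiveEndo τ hq.injective, hq, hτ'⟩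

theorem IsChainNine.form_eq_zero_of_smul_mem {R : Submodule ℤ E10} {w : E10}
    (hR : IsChainNine R w) {c : ℤ} (hc : c ≠ 0) {x : E10} (hx : c • x ∈ R) : x ⬝ₑ w = 0 := by
  have := hR.form_eq_zero _ hx
  rw [form_smul_left] at this
  exact (mul_eq_zero.1 this).resolve_left hc

theorem IsChainNine.card_eq {R R' : Submodule ℤ E10} {w : E10} (hR : IsChainNine R w)
    (hR' : ∀ x, x ∈ R' ↔ ∃ c : ℤ, c ≠ 0 ∧ c • x ∈ R) :
    Nat.card {h : V10 ≃ₗ[ZMod 2] V10 //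
        (∀ v, q2 (h v) = q2 v) ∧ (∀ v ∈ red '' (R : Set E10), h v = v) ∧
        (⇑h) '' (red '' (R' : Set E10)) = red '' (R' : Set E10)} =
      2 * Nat.card {h : V10 ≃ₗ[ZMod 2] V10 //
        ((∀ v, q2 (h v) = q2 v) ∧ (∀ v ∈ red '' (R : Set E10), h v = v) ∧
          (⇑h) '' (red '' (R' : Set E10)) = red '' (R' : Set E10)) ∧
        ∃ g : E10 ≃ₗ[ℤ] E10,
          (∀ a b, g a ⬝ₑ g b = a ⬝ₑ b) ∧ (∀ r ∈ R, g r = r) ∧ ∀ x, red (g x) = h (red x)} := by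
  obtain ⟨τ, hτq, hτ⟩ := exists_twist hR.form_self
  have hτ1 : LinearEquiv.refl (ZMod 2) V10 ≠ τ := by
    rintro rfl
    obtain ⟨x, hx⟩ := hR.exists_form_eq_one
    obtain ⟨z, hz⟩ := red_eq_red_iff.1 (hτ x).symm
    rw [hx, one_smul, add_right_inj] at hz
    have hxw : x ⬝ₑ w = 2 * (x ⬝ₑ z) := by
      conv_lhs => rw [hz]
      rw [form_smul_right]
    omega
  have hmem : ∀ r ∈ R, r ∈ R' := fun r hr => (hR' r).2 ⟨1, one_ne_zero, by rwa [one_smul]⟩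
  have hτR' : ∀ x ∈ R', τ (red x) = red x := fun x hx => by
    obtain ⟨c, hc, hcx⟩ := (hR' x).1 hx
    rw [hτ, hR.form_eq_zero_of_smul_mem hc hcx, zero_smul, add_zero]
  have hS : {h : V10 ≃ₗ[ZMod 2] V10 |
      (∀ v, q2 (h v) = q2 v) ∧ (∀ v ∈ red '' (R : Set E10), h v = v) ∧
      (⇑h) '' (red '' (R' : Set E10)) = red '' (R' : Set E10)} =
        {LinearEquiv.refl (ZMod 2) V10, τ} := by
    ext h
    constructor
    · rintro ⟨hq, hfix, -⟩
      refine (hR.reduction_eq (h : V10 →ₗ[ZMod 2] V10) hq fun r hr =>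
        hfix _ ⟨r, hr, rfl⟩).imp (fun H => ?_) fun H => ?_ <;>
      · refine LinearEquiv.ext fun v => ?_
        obtain ⟨x, rfl⟩ := red_surjective v
        first | exact H x | exact (H x).trans (hτ x).symm
    · rintro (rfl | rfl)
      · exact ⟨fun _ => rfl, fun _ _ => rfl, Set.image_id _⟩
      · refine ⟨hτq, ?_, ?_⟩
        · rintro _ ⟨r, hr, rfl⟩
          exact hτR' r (hmem r hr)
        · rw [Set.image_image]
          exact Set.image_congr hτR'
  have hT : {h : V10 ≃ₗ[ZMod 2] V10 |
      ((∀ v, q2 (h v) = q2 v) ∧ (∀ v ∈ red '' (R : Set E10), h v = v) ∧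
        (⇑h) '' (red '' (R' : Set E10)) = red '' (R' : Set E10)) ∧
      ∃ g : E10 ≃ₗ[ℤ] E10,
        (∀ a b, g a ⬝ₑ g b = a ⬝ₑ b) ∧ (∀ r ∈ R, g r = r) ∧ ∀ x, red (g x) = h (red x)} =
          {LinearEquiv.refl (ZMod 2) V10} := by
    ext h
    constructor
    · rintro ⟨-, g, hg, hfix, hgh⟩
      refine LinearEquiv.ext fun v => ?_
      obtain ⟨x, rfl⟩ := red_surjective v
      rw [← hgh, show g x = x from hR.eq_id g hg hfix x]
      rfl
    · rintro rfl
      exact ⟨⟨fun _ => rfl, fun _ _ => rfl, Set.image_id _⟩, LinearEquiv.refl ℤ E10,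
        fun _ _ => rfl, fun _ _ => rfl, fun _ => rfl⟩
  rw [← Set.coe_ofPred, ← Set.coe_ofPred, Nat.card_coe_set_eq, Nat.card_coe_set_eq, hS, hT,
    Set.ncard_pair hτ1, Set.ncard_singleton]

theorem isIrreducibleRootLattice_of_not_exists {R : Submodule ℤ E10}
    (hroot : R = Submodule.span ℤ {r : E10 | r ∈ R ∧ r ⬝ₑ r = -2})
    (hirr : ¬ ∃ S T : Set E10, S ∪ T = {r : E10 | r ∈ R ∧ r ⬝ₑ r = -2} ∧
      S.Nonempty ∧ T.Nonempty ∧ S ∩ T = ∅ ∧ ∀ s ∈ S, ∀ t ∈ T, s ⬝ₑ t = 0) :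
    IsIrreducibleRootLattice R where
  span_roots := hroot.le
  irreducible P hP := by
    by_contra! hcon
    obtain ⟨⟨t, ht, htt, hPt⟩, s, hs, hss, hPs⟩ := hcon
    refine hirr ⟨{r | (r ∈ R ∧ r ⬝ₑ r = -2) ∧ P r}, {r | (r ∈ R ∧ r ⬝ₑ r = -2) ∧ ¬ P r}, ?_,
      ⟨s, ⟨hs, hss⟩, hPs⟩, ⟨t, ⟨ht, htt⟩, hPt⟩, ?_, fun a ha b hb =>
        hP a ha.1.1 ha.1.2 b hb.1.1 hb.1.2 ha.2 hb.2⟩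
    · ext r
      by_cases h : P r <;> simp [h]
    · ext r
      by_cases h : P r <;> simp [h]

theorem PreservesForm.exists_reduction_stabilizer {R R' : Submodule ℤ E10}
    (hR' : ∀ x, x ∈ R' ↔ ∃ c : ℤ, c ≠ 0 ∧ c • x ∈ R) {g : E10 ≃ₗ[ℤ] E10}
    (hg : PreservesForm (g : E10 →ₗ[ℤ] E10)) (hfix : ∀ r ∈ R, g r = r) :
    ∃ h : V10 ≃ₗ[ZMod 2] V10,
      (∀ v, q2 (h v) = q2 v) ∧ (∀ x, red (g x) = h (red x)) ∧
      (∀ v ∈ red '' (R : Set E10), h v = v) ∧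
      (⇑h) '' (red '' (R' : Set E10)) = red '' (R' : Set E10) := by
  obtain ⟨h, hq, hgh⟩ := hg.exists_reduction
  have hR'fix : ∀ x ∈ R', g x = x := fun x hx => by
    obtain ⟨c, hc, hcx⟩ := (hR' x).1 hx
    have := hfix _ hcx
    rw [map_smul] at this
    exact smul_right_injective _ hc this
  refine ⟨h, hq, hgh, ?_, ?_⟩
  · rintro _ ⟨r, hr, rfl⟩
    rw [← hgh, hfix r hr]
  · rw [Set.image_image]
    exact Set.image_congr fun x hx => by rw [← hgh, hR'fix x hx]

theorem IsLiftable.exists_equiv {R R' : Submodule ℤ E10} (hR : IsLiftable R)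
    (hR' : ∀ x, x ∈ R' ↔ ∃ c : ℤ, c ≠ 0 ∧ c • x ∈ R) {h : V10 ≃ₗ[ZMod 2] V10}
    (hq : ∀ v, q2 (h v) = q2 v) (hfix : ∀ v ∈ red '' (R : Set E10), h v = v)
    (himg : (⇑h) '' (red '' (R' : Set E10)) = red '' (R' : Set E10)) :
    ∃ g : E10 ≃ₗ[ℤ] E10,
      (∀ a b, g a ⬝ₑ g b = a ⬝ₑ b) ∧ (∀ r ∈ R, g r = r) ∧ ∀ x, red (g x) = h (red x) := by
  obtain ⟨g, hg, hgfix, hgh⟩ := hR h hq (fun r hr => hfix _ ⟨r, hr, rfl⟩) fun x hx =>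
    preserves_red_orthogonal hR' (h := (h : V10 →ₗ[ZMod 2] V10)) hq himg.ge hx
  obtain ⟨e, rfl⟩ := hg.exists_equiv
  exact ⟨e, hg, hgfix, hgh⟩

theorem not_isometricToA9_of_apply_eq_zero {R : Submodule ℤ E10} {e : E10 ≃ₗ[ℤ] E10}
    (he : PreservesForm (e : E10 →ₗ[ℤ] E10))
    (h : (∀ r ∈ R.map (e : E10 →ₗ[ℤ] E10), r 1 = 0) ∨
      ∀ r ∈ R.map (e : E10 →ₗ[ℤ] E10), r 8 = 0) : ¬ IsometricToA9 R := by
  have key : ∀ k, (∀ r ∈ R.map (e : E10 →ₗ[ℤ] E10), r k = 0) →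
      e.symm (weight k) ⬝ₑ e.symm (weight k) = weight k ⬝ₑ weight k ∧
      ∀ r ∈ R, r ⬝ₑ e.symm (weight k) = 0 := fun k hk => by
    refine ⟨he.symm _ _, fun r hr => ?_⟩
    have := he r (e.symm (weight k))
    rw [LinearEquiv.coe_coe, e.apply_symm_apply, form_weight] at this
    rw [← this]
    exact hk _ ⟨r, hr, rfl⟩
  rcases h with h | h
  · refine not_isometricToA9 (.inl ?_) (key _ h).2
    rw [(key _ h).1, form_weight, weight_apply]
    decide +kernel
  · refine not_isometricToA9 (.inr ?_) (key _ h).2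
    rw [(key _ h).1, form_weight, weight_apply]
    decide +kernel

/-- For `R ⊆ E₁₀` an irreducible negative definite root sublattice with
primitive closure `R'`, every element of the pointwise stabilizer `O(E₁₀)_R` reduces
mod `2` to an isometry of `(F₂^10, q)` fixing `R̄` pointwise and preserving `R̄'`;
this reduction map `ξ` is surjective onto `O(E₁₀ ⊗ F₂)_{R̄,{R̄'}}` unless `R ≅ A₉`,
in which case its image has index `2`. -/
theorem reduction_stabilizer_surjective (R R' : Submodule ℤ (Fin 10 → ℤ))
    (hroot : R = Submodule.span ℤ {r : Fin 10 → ℤ | r ∈ R ∧ e10Form r r = -2})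
    (hnegdef : ∀ x ∈ R, x ≠ 0 → e10Form x x < 0)
    (hirr : ¬ ∃ S T : Set (Fin 10 → ℤ),
        S ∪ T = {r : Fin 10 → ℤ | r ∈ R ∧ e10Form r r = -2} ∧
        S.Nonempty ∧ T.Nonempty ∧ S ∩ T = ∅ ∧ ∀ s ∈ S, ∀ t ∈ T, e10Form s t = 0)
    (hR' : ∀ x : Fin 10 → ℤ, x ∈ R' ↔ ∃ c : ℤ, c ≠ 0 ∧ c • x ∈ R) :
    (∀ g : (Fin 10 → ℤ) ≃ₗ[ℤ] (Fin 10 → ℤ),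
        (∀ a b, e10Form (g a) (g b) = e10Form a b) → (∀ r ∈ R, g r = r) →
        ∃ h : (Fin 10 → ZMod 2) ≃ₗ[ZMod 2] (Fin 10 → ZMod 2),
          (∀ v, q2 (h v) = q2 v) ∧ (∀ x, red (g x) = h (red x)) ∧
          (∀ v ∈ red '' (R : Set (Fin 10 → ℤ)), h v = v) ∧
          (⇑h) '' (red '' (R' : Set (Fin 10 → ℤ))) = red '' (R' : Set (Fin 10 → ℤ))) ∧
    (¬ IsometricToA9 R →
      ∀ h : (Fin 10 → ZMod 2) ≃ₗ[ZMod 2] (Fin 10 → ZMod 2),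
        (∀ v, q2 (h v) = q2 v) → (∀ v ∈ red '' (R : Set (Fin 10 → ℤ)), h v = v) →
        (⇑h) '' (red '' (R' : Set (Fin 10 → ℤ))) = red '' (R' : Set (Fin 10 → ℤ)) →
        ∃ g : (Fin 10 → ℤ) ≃ₗ[ℤ] (Fin 10 → ℤ),
          (∀ a b, e10Form (g a) (g b) = e10Form a b) ∧ (∀ r ∈ R, g r = r) ∧
          ∀ x, red (g x) = h (red x)) ∧
    (IsometricToA9 R →
      Nat.card {h : (Fin 10 → ZMod 2) ≃ₗ[ZMod 2] (Fin 10 → ZMod 2) //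
          (∀ v, q2 (h v) = q2 v) ∧ (∀ v ∈ red '' (R : Set (Fin 10 → ℤ)), h v = v) ∧
          (⇑h) '' (red '' (R' : Set (Fin 10 → ℤ))) = red '' (R' : Set (Fin 10 → ℤ))} =
        2 * Nat.card {h : (Fin 10 → ZMod 2) ≃ₗ[ZMod 2] (Fin 10 → ZMod 2) //
          ((∀ v, q2 (h v) = q2 v) ∧ (∀ v ∈ red '' (R : Set (Fin 10 → ℤ)), h v = v) ∧
            (⇑h) '' (red '' (R' : Set (Fin 10 → ℤ))) = red '' (R' : Set (Fin 10 → ℤ))) ∧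
          ∃ g : (Fin 10 → ℤ) ≃ₗ[ℤ] (Fin 10 → ℤ),
            (∀ a b, e10Form (g a) (g b) = e10Form a b) ∧ (∀ r ∈ R, g r = r) ∧
            ∀ x, red (g x) = h (red x)}) := by
  refine ⟨fun g hg hfix => PreservesForm.exists_reduction_stabilizer hR' hg hfix, ?_⟩
  obtain ⟨g, hg, hcase⟩ :=
    isLiftable_or_chain (isIrreducibleRootLattice_of_not_exists hroot hirr) hnegdef
  obtain ⟨e, rfl⟩ := hg.exists_equiv
  rcases hcase with ⟨hlift, hzero⟩ | ⟨hmem, hzero⟩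
  · exact ⟨fun _ h hq hfix himg => (hlift.of_map hg).exists_equiv hR' hq hfix himg,
      fun h => absurd h (not_isometricToA9_of_apply_eq_zero hg hzero)⟩
  · have hchain := (isChainNine_of_simpleRoot_mem hmem hzero).of_map hg
    exact ⟨fun h => absurd hchain.isometric h, fun _ => hchain.card_eq hR'⟩
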